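/- arXiv:1207.6674 — 2 statements merged into one kernel-verified Lean document; each statement's English description precedes it below -/
import Mathlib

section
/- Let D be the dust-like attractor and T the touching attractor with the same contraction vector (ρ₁,…,ρₙ), n ≥ 3, as in the standing setup. If there exists a bi-Lipschitz bijection f : D → T, then log ρ₁ / log ρₙ is rational. -/
noncomputable section

open Set Metric MeasureTheory

/-- Distance between two sets. -/
def setDist {X : Type*} [MetricSpace X] (A B : Set X) : ℝ := sInf (Set.image2 dist A B)

/-- Lipschitz equivalence of two sets: a bi-Lipschitz bijection between them. -/
def LipEquivOn {X Y : Type*} [MetricSpace X] [MetricSpace Y] (E : Set X) (F : Set Y) : Prop :=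
  ∃ (f : X → Y) (c c' : ℝ), 0 < c ∧ c ≤ c' ∧ Set.BijOn f E F ∧
    ∀ x ∈ E, ∀ y ∈ E, c * dist x y ≤ dist (f x) (f y) ∧ dist (f x) (f y) ≤ c' * dist x y

/-- The affine contraction `x ↦ ρ i * x + t i`. -/
def affMap (r t : ℕ → ℝ) (i : ℕ) (x : ℝ) : ℝ := r i * x + t i

/-- Composition of the affine maps along a word (first letter outermost). -/
def affWord (r t : ℕ → ℝ) : List ℕ → ℝ → ℝ
  | [] => id
  | i :: w => affMap r t i ∘ affWord r t w

/-- Cylinder of a general IFS for a word over `Fin n`. -/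
def cylW {X : Type*} {n : ℕ} (Ψ : Fin n → X → X) (F : Set X) (w : List (Fin n)) : Set X :=
  (w.foldr (fun i g => Ψ i ∘ g) id) '' F

/-- A (separable) contraction vector `(ρ 0, …, ρ (n-1))` in `ℝ`. -/
structure ContractionVec (n : ℕ) (ρ : ℕ → ℝ) : Prop where
  three_le : 3 ≤ n
  pos : ∀ i, i < n → 0 < ρ i
  lt_one : ∀ i, i < n → ρ i < 1
  sum_lt : (∑ i ∈ Finset.range n, ρ i) < 1

/-- The touching IFS of the standing setup, together with its attractor `T`. -/
structure TouchingIFS (n : ℕ) (ρ : ℕ → ℝ) where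
  t : ℕ → ℝ
  T : Set ℝ
  order : ∀ i, i + 1 < n → affMap ρ t i 1 ≤ affMap ρ t (i + 1) 0
  left0 : affMap ρ t 0 0 = 0
  right1 : affMap ρ t (n - 1) 1 = 1
  touch_ex : ∃ i, i + 1 < n ∧ affMap ρ t i 1 = affMap ρ t (i + 1) 0
  compactT : IsCompact T
  nonemptyT : T.Nonempty
  invT : T = ⋃ i ∈ Finset.range n, affMap ρ t i '' T

/-- The dust-like, equally spaced IFS of the standing setup, with attractor `D`. -/
structure DustIFS (n : ℕ) (ρ : ℕ → ℝ) where
  d : ℕ → ℝ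
  D : Set ℝ
  left0 : affMap ρ d 0 0 = 0
  right1 : affMap ρ d (n - 1) 1 = 1
  equal_gap : ∀ i, i + 1 < n →
    affMap ρ d (i + 1) 0 - affMap ρ d i 1 = (1 - ∑ j ∈ Finset.range n, ρ j) / (n - 1)
  compactD : IsCompact D
  nonemptyD : D.Nonempty
  invD : D = ⋃ i ∈ Finset.range n, affMap ρ d i '' D

variable {n : ℕ} {ρ : ℕ → ℝ}

/-- Cylinder `T_w`. -/
def TouchingIFS.cyl (S : TouchingIFS n ρ) (w : List ℕ) : Set ℝ := affWord ρ S.t w '' S.T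

/-- `i` is a (left) touching letter. -/
def TouchingIFS.touch (S : TouchingIFS n ρ) (i : ℕ) : Prop :=
  i + 1 < n ∧ affMap ρ S.t i 1 = affMap ρ S.t (i + 1) 0

/-- Left touching patch `L_k(T_w)` (with `α` the initial touching run length). -/
def TouchingIFS.patchL (S : TouchingIFS n ρ) (α : ℕ) (w : List ℕ) (k : ℕ) : Set ℝ :=
  ⋃ j ∈ Finset.range α, S.cyl (w ++ List.replicate k 0 ++ [j])

/-- Right touching patch `R_k(T_w)` (with `β` the final touching run length). -/
def TouchingIFS.patchR (S : TouchingIFS n ρ) (β : ℕ) (w : List ℕ) (k : ℕ) : Set ℝ :=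
  ⋃ j ∈ Finset.Ico (n - β) n, S.cyl (w ++ List.replicate k (n - 1) ++ [j])

/-- `α` is the number of successive touching intervals at the beginning. -/
def TouchingIFS.alphaRun (S : TouchingIFS n ρ) (α : ℕ) : Prop :=
  1 ≤ α ∧ α < n ∧ (∀ i, i + 1 < α → S.touch i) ∧ ¬ S.touch (α - 1)

/-- `β` is the number of successive touching intervals at the end. -/
def TouchingIFS.betaRun (S : TouchingIFS n ρ) (β : ℕ) : Prop :=
  1 ≤ β ∧ β < n ∧ (∀ i, n - β ≤ i → i + 1 < n → S.touch i) ∧ ¬ S.touch (n - β - 1)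

/-- Cylinder `D_w`. -/
def DustIFS.cyl (Q : DustIFS n ρ) (w : List ℕ) : Set ℝ := affWord ρ Q.d w '' Q.D

/-- Left patch `L_k(D_w)`. -/
def DustIFS.patchL (Q : DustIFS n ρ) (α : ℕ) (w : List ℕ) (k : ℕ) : Set ℝ :=
  ⋃ j ∈ Finset.range α, Q.cyl (w ++ List.replicate k 0 ++ [j])

/-- Right patch `R_k(D_w)`. -/
def DustIFS.patchR (Q : DustIFS n ρ) (β : ℕ) (w : List ℕ) (k : ℕ) : Set ℝ :=
  ⋃ j ∈ Finset.Ico (n - β) n, Q.cyl (w ++ List.replicate k (n - 1) ++ [j])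

/-- `τ k` is the unique positive integer with `ρₙᵏ ρ₁ < ρ₁ ^ τ(k) ≤ ρₙᵏ`. -/
def tauSpec (ρ : ℕ → ℝ) (n : ℕ) (τ : ℕ → ℕ) : Prop :=
  ∀ k, 1 ≤ k → 1 ≤ τ k ∧ ρ (n - 1) ^ k * ρ 0 < ρ 0 ^ τ k ∧ ρ 0 ^ τ k ≤ ρ (n - 1) ^ k

/-- `Cᵏ = R_k(T_{i₀}) ∪ L_{τ(k)}(T_{i₀+1})`. -/
def Cset (S : TouchingIFS n ρ) (α β i₀ : ℕ) (τ : ℕ → ℕ) (k : ℕ) : Set ℝ :=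
  S.patchR β [i₀] k ∪ S.patchL α [i₀ + 1] (τ k)

/-- The touching letter `i` is left substitutable. -/
def TouchingIFS.LeftSub (S : TouchingIFS n ρ) (α : ℕ) (i : ℕ) : Prop :=
  ∃ (w : List ℕ) (a : ℕ) (k k' : ℕ), (∀ b ∈ w ++ [a], b < n) ∧
    Metric.diam (S.patchL α [i + 1] k) = Metric.diam (S.patchL α (i :: (w ++ [a])) k') ∧
    a ≠ 0 ∧ ∀ ℓ, S.touch ℓ → a ≠ ℓ + 1

/-- The touching letter `i` is right substitutable. -/
def TouchingIFS.RightSub (S : TouchingIFS n ρ) (β : ℕ) (i : ℕ) : Prop :=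
  ∃ (w : List ℕ) (a : ℕ) (k k' : ℕ), (∀ b ∈ w ++ [a], b < n) ∧
    Metric.diam (S.patchR β [i] k) = Metric.diam (S.patchR β ((i + 1) :: (w ++ [a])) k') ∧
    a ≠ n - 1 ∧ ¬ S.touch a

/-- Convex hull of a bounded set of reals: the minimal closed interval containing it. -/
def CH (B : Set ℝ) : Set ℝ := Set.Icc (sInf B) (sSup B)

/-- `[a,b]` is a maximal run of touching letters (a first-level connected component). -/
def TouchingIFS.run (S : TouchingIFS n ρ) (a b : ℕ) : Prop :=
  a ≤ b ∧ b < n ∧ (∀ i, a ≤ i → i < b → S.touch i) ∧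
  (a = 0 ∨ ¬ S.touch (a - 1)) ∧ (b = n - 1 ∨ ¬ S.touch b)

/-- Membership in the class `𝒯⁽¹⁾`: a `T`-separate copy `Ψ_w(T⁽¹⁾_j)`. -/
def TouchingIFS.T1mem (S : TouchingIFS n ρ) (X : Set ℝ) : Prop :=
  ∃ (w : List ℕ) (a b : ℕ), (∀ c ∈ w, c < n) ∧ S.run a b ∧
    X = affWord ρ S.t w '' (⋃ j ∈ Finset.Icc a b, S.cyl [j]) ∧
    0 < setDist X (S.T \ X)

/-- Membership in the class `𝒯⁽²⁾`: a copy `Ψ_w(T⁽²⁾_i) = Ψ_w(R₀(T_i) ∪ L₀(T_{i+1}))`. -/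
def TouchingIFS.T2mem (S : TouchingIFS n ρ) (α β : ℕ) (X : Set ℝ) : Prop :=
  ∃ (w : List ℕ) (i : ℕ), (∀ c ∈ w, c < n) ∧ S.touch i ∧
    X = affWord ρ S.t w '' (S.patchR β [i] 0 ∪ S.patchL α [i + 1] 0)

/-- An admissible family for the simple decomposition of `E` by the `A i`. -/
def GoodFam (E : Set ℝ) {k : ℕ} (A : Fin k → Set ℝ) (𝒮 : Finset (Set ℝ)) : Prop :=
  (∀ B ∈ 𝒮, IsCompact B ∧ B ⊆ E) ∧ (⋃ B ∈ 𝒮, B) = E ∧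
  (∀ B ∈ 𝒮, ∀ B' ∈ 𝒮, B ≠ B' → CH B ∩ CH B' = ∅) ∧ (∀ i, A i ∈ 𝒮)


section helpers

/-- word map -/
def wMap {ι : Type*} (r t : ι → ℝ) : List ι → ℝ → ℝ
  | [], x => x
  | i :: w, x => r i * wMap r t w x + t i

/-- product of weights along a word -/
def wProd {ι : Type*} (r : ι → ℝ) (w : List ι) : ℝ := (w.map r).prod

theorem wMap_append {ι : Type*} (r t : ι → ℝ) (u w : List ι) (x : ℝ) :
    wMap r t (u ++ w) x = wMap r t u (wMap r t w x) := by
  induction u with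
  | nil => rfl
  | cons i u ih => simp [wMap, ih]

theorem wProd_append {ι : Type*} (r : ι → ℝ) (u w : List ι) :
    wProd r (u ++ w) = wProd r u * wProd r w := by
  simp [wProd]

theorem wProd_cons {ι : Type*} (r : ι → ℝ) (i : ι) (w : List ι) :
    wProd r (i :: w) = r i * wProd r w := by
  simp [wProd]

theorem wProd_nil {ι : Type*} (r : ι → ℝ) : wProd r [] = 1 := by simp [wProd]

theorem wProd_pos {ι : Type*} {r : ι → ℝ} (hr : ∀ i, 0 < r i) (w : List ι) :
    0 < wProd r w := by
  induction w with
  | nil => simp [wProd]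
  | cons i u ih => rw [wProd_cons]; exact mul_pos (hr i) ih

theorem wProd_rpow {ι : Type*} {r : ι → ℝ} (hr : ∀ i, 0 < r i) (s : ℝ) (w : List ι) :
    wProd (fun i => r i ^ s) w = wProd r w ^ s := by
  induction w with
  | nil => simp [wProd]
  | cons i u ih =>
    rw [wProd_cons, wProd_cons, ih, Real.mul_rpow (hr i).le (wProd_pos hr u).le]

theorem wProd_le_pow {ι : Type*} {r : ι → ℝ} (hr : ∀ i, 0 < r i) {q : ℝ} (hq : 0 ≤ q)
    (h : ∀ i, r i ≤ q) (w : List ι) : wProd r w ≤ q ^ w.length := by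
  induction w with
  | nil => simp [wProd]
  | cons i u ih =>
    rw [wProd_cons, List.length_cons, pow_succ']
    exact mul_le_mul (h i) ih (wProd_pos hr u).le hq

theorem wMap_sub {ι : Type*} (r t : ι → ℝ) (w : List ι) (x y : ℝ) :
    wMap r t w x - wMap r t w y = wProd r w * (x - y) := by
  induction w with
  | nil => simp [wMap, wProd]
  | cons i u ih =>
    rw [wProd_cons]
    simp only [wMap]
    rw [mul_assoc, ← ih]; ring

theorem wMap_inj {ι : Type*} {r : ι → ℝ} (hr : ∀ i, 0 < r i) (t : ι → ℝ) (w : List ι) :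
    Function.Injective (wMap r t w) := by
  intro x y h
  have := wMap_sub r t w x y
  rw [h, sub_self] at this
  have h2 := (mul_eq_zero.1 this.symm).resolve_left (wProd_pos hr w).ne'
  linarith

theorem wMap_le {ι : Type*} {r : ι → ℝ} (hr : ∀ i, 0 < r i) (t : ι → ℝ) (w : List ι)
    {x y : ℝ} (h : x ≤ y) : wMap r t w x ≤ wMap r t w y := by
  have := wMap_sub r t w y x
  have h2 := mul_nonneg (wProd_pos hr w).le (sub_nonneg.2 h)
  linarith

theorem wMap_lt_iff {ι : Type*} {r : ι → ℝ} (hr : ∀ i, 0 < r i) (t : ι → ℝ) (w : List ι)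
    {x y : ℝ} : wMap r t w x < wMap r t w y ↔ x < y := by
  constructor
  · intro h
    by_contra hc
    exact absurd (wMap_le hr t w (not_lt.1 hc)) (not_le.2 h)
  · intro h
    exact lt_of_le_of_ne (wMap_le hr t w h.le) fun e => h.ne (wMap_inj hr t w e)

/-- Abstract invariant set in the unit interval. -/
structure SInv {ι : Type*} (r t : ι → ℝ) (D : Set ℝ) : Prop where
  pos : ∀ i, 0 < r i
  lt : ∀ i, r i < 1
  sub : D ⊆ Set.Icc 0 1
  ne : D.Nonempty
  maps : ∀ i, ∀ x ∈ D, r i * x + t i ∈ D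
  surj : ∀ x ∈ D, ∃ i, ∃ y ∈ D, r i * y + t i = x

theorem SInv.wmaps {ι : Type*} {r t : ι → ℝ} {D : Set ℝ} (h : SInv r t D) (w : List ι) :
    ∀ x ∈ D, wMap r t w x ∈ D := by
  induction w with
  | nil => intro x hx; exact hx
  | cons i u ih => intro x hx; exact h.maps i _ (ih x hx)

open Classical in
/-- Level `k` approximation of the natural measure. -/
def Nk {ι : Type*} [Fintype ι] (r d p : ι → ℝ) (D : Set ℝ) : ℕ → Set ℝ → ℝ
  | 0, A => if (A ∩ D).Nonempty then 1 else 0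
  | k + 1, A => ∑ i, p i * Nk r d p D k ((fun x => r i * x + d i) ⁻¹' A)

/-- natural content -/
def mC {ι : Type*} [Fintype ι] (r d p : ι → ℝ) (D : Set ℝ) (A : Set ℝ) : ℝ :=
  ⨅ k, Nk r d p D k A

section content
variable {ι : Type*} [Fintype ι] {r d p : ι → ℝ} {D : Set ℝ}

theorem Nk_nonneg (hp : ∀ i, 0 < p i) (k : ℕ) (A : Set ℝ) : 0 ≤ Nk r d p D k A := by
  induction k generalizing A with
  | zero => simp only [Nk]; split_ifs <;> norm_num
  | succ k ih => exact Finset.sum_nonneg fun i _ => mul_nonneg (hp i).le (ih _)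

theorem Nk_anti (h : SInv r d D) (hp : ∀ i, 0 < p i) (hs : ∑ i, p i = 1) (k : ℕ) (A : Set ℝ) :
    Nk r d p D (k + 1) A ≤ Nk r d p D k A := by
  induction k generalizing A with
  | zero =>
    simp only [Nk]
    split_ifs with hA
    · calc _ ≤ ∑ i, p i := by
            apply Finset.sum_le_sum
            intro i _
            split_ifs <;> linarith [hp i]
        _ ≤ 1 := hs.le
    · apply le_of_eq
      apply Finset.sum_eq_zero
      intro i _
      rw [if_neg, mul_zero]
      rintro ⟨x, hx, hxD⟩
      exact hA ⟨_, hx, h.maps i x hxD⟩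
  | succ k ih =>
    exact Finset.sum_le_sum fun i _ => mul_le_mul_of_nonneg_left (ih _) (hp i).le

theorem mC_tendsto (h : SInv r d D) (hp : ∀ i, 0 < p i) (hs : ∑ i, p i = 1) (A : Set ℝ) :
    Filter.Tendsto (fun k => Nk r d p D k A) Filter.atTop (nhds (mC r d p D A)) := by
  apply tendsto_atTop_ciInf
  · exact antitone_nat_of_succ_le fun k => Nk_anti h hp hs k A
  · refine ⟨0, ?_⟩
    rintro _ ⟨k, rfl⟩
    exact Nk_nonneg hp k A

theorem mC_step (h : SInv r d D) (hp : ∀ i, 0 < p i) (hs : ∑ i, p i = 1) (A : Set ℝ) :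
    mC r d p D A = ∑ i, p i * mC r d p D ((fun x => r i * x + d i) ⁻¹' A) := by
  have h1 := (Filter.tendsto_add_atTop_iff_nat 1).2 (mC_tendsto h hp hs A)
  refine tendsto_nhds_unique h1 ?_
  simp only [Nk]
  exact tendsto_finsetSum _ fun i _ => (mC_tendsto h hp hs _).const_mul (p i)

theorem mC_mono (h : SInv r d D) (hp : ∀ i, 0 < p i) (hs : ∑ i, p i = 1) {A B : Set ℝ}
    (hAB : A ∩ D ⊆ B) : mC r d p D A ≤ mC r d p D B := by
  refine le_of_tendsto_of_tendsto' (mC_tendsto h hp hs A) (mC_tendsto h hp hs B) fun k => ?_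
  induction k generalizing A B with
  | zero =>
    simp only [Nk]
    split_ifs with h1 h2
    · exact le_rfl
    · exfalso
      obtain ⟨x, hx⟩ := h1
      exact h2 ⟨x, hAB hx, hx.2⟩
    · norm_num
    · exact le_rfl
  | succ k ih =>
    refine Finset.sum_le_sum fun i _ => mul_le_mul_of_nonneg_left (ih ?_) (hp i).le
    rintro x ⟨hx, hxD⟩
    exact hAB ⟨hx, h.maps i x hxD⟩

theorem mC_union (h : SInv r d D) (hp : ∀ i, 0 < p i) (hs : ∑ i, p i = 1) (A B : Set ℝ) :
    mC r d p D (A ∪ B) ≤ mC r d p D A + mC r d p D B := by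
  refine le_of_tendsto_of_tendsto' (mC_tendsto h hp hs _)
    ((mC_tendsto h hp hs A).add (mC_tendsto h hp hs B)) fun k => ?_
  induction k generalizing A B with
  | zero =>
    simp only [Nk]
    split_ifs with h1 h2 h3 h3 h4 h5 <;> try norm_num
    obtain ⟨x, hx | hx, hD⟩ := h1
    · exact h2 ⟨x, hx, hD⟩
    · exact h3 ⟨x, hx, hD⟩
  | succ k ih =>
    simp only [Nk, ← Finset.sum_add_distrib, ← mul_add]
    exact Finset.sum_le_sum fun i _ => mul_le_mul_of_nonneg_left (ih _ _) (hp i).le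

theorem mC_nonneg (hp : ∀ i, 0 < p i) (A : Set ℝ) :
    0 ≤ mC r d p D A := le_ciInf fun k => Nk_nonneg hp k A

theorem mC_zero (hp : ∀ i, 0 < p i) {A : Set ℝ}
    (hA : ∀ x ∈ A, x ∉ D) : mC r d p D A = 0 := by
  apply le_antisymm _ (mC_nonneg hp A)
  have : mC r d p D A ≤ Nk r d p D 0 A :=
    ciInf_le ⟨0, by rintro _ ⟨k, rfl⟩; exact Nk_nonneg hp k A⟩ 0
  refine this.trans (le_of_eq ?_)
  simp only [Nk]
  rw [if_neg]
  rintro ⟨x, hx, hxD⟩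
  exact hA x hx hxD

theorem mC_one (h : SInv r d D) (hs : ∑ i, p i = 1) {A : Set ℝ}
    (hA : D ⊆ A) : mC r d p D A = 1 := by
  have : ∀ k, Nk r d p D k A = 1 := by
    intro k
    induction k generalizing A with
    | zero =>
      simp only [Nk]
      rw [if_pos]
      obtain ⟨x, hx⟩ := h.ne
      exact ⟨x, hA hx, hx⟩
    | succ k ih =>
      simp only [Nk]
      rw [← hs]
      refine Finset.sum_congr rfl fun i _ => ?_
      rw [ih, mul_one]
      intro x hx
      exact hA (h.maps i x hx)
  simp [mC, this]

/-- gap condition -/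
def Gap (r d : ι → ℝ) (D : Set ℝ) (g : ℝ) : Prop :=
  ∀ i j, i ≠ j → ∀ x ∈ D, ∀ y ∈ D, g ≤ |(r i * x + d i) - (r j * y + d j)|

theorem mC_cyl (h : SInv r d D) (hp : ∀ i, 0 < p i) (hs : ∑ i, p i = 1) {g : ℝ} (hg : 0 < g)
    (hG : Gap r d D g) (w : List ι) {A : Set ℝ} (hA : A ∩ D ⊆ wMap r d w '' D) :
    mC r d p D A = wProd p w * mC r d p D (wMap r d w ⁻¹' A) := by
  induction w generalizing A with
  | nil => simp only [wProd_nil, one_mul]; rfl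
  | cons i u ih =>
    rw [mC_step h hp hs A, Finset.sum_eq_single i]
    · rw [ih, wProd_cons, mul_assoc]
      · rfl
      · rintro x ⟨hx, hxD⟩
        obtain ⟨y, hy, hxy⟩ := hA ⟨hx, h.maps i x hxD⟩
        refine ⟨y, hy, ?_⟩
        simp only [wMap] at hxy
        have := h.pos i
        have h3 : r i * wMap r d u y = r i * x := by linarith
        exact mul_left_cancel₀ this.ne' h3
    · intro j _ hj
      rw [mC_zero hp, mul_zero]
      intro x hx hxD
      obtain ⟨y, hy, hxy⟩ := hA ⟨hx, h.maps j x hxD⟩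
      have := hG j i hj x hxD _ (h.wmaps u y hy)
      simp only [wMap] at hxy
      rw [hxy, sub_self, abs_zero] at this
      linarith
    · intro hi; exact absurd (Finset.mem_univ i) hi

/-- finite value sets -/
def VL (p : ι → ℝ) : ℕ → Set ℝ
  | 0 => {0, 1}
  | L + 1 => (fun a : ι → ℝ => ∑ i, p i * a i) '' (Set.univ.pi fun _ => VL p L)

theorem VL_finite (p : ι → ℝ) (L : ℕ) : (VL p L).Finite := by
  induction L with
  | zero => simp [VL]
  | succ L ih => exact (Set.Finite.pi' fun _ => ih).subset (by intro a ha; simpa using ha) |>.image _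

theorem mC_mem_VL (h : SInv r d D) (hp : ∀ i, 0 < p i) (hs : ∑ i, p i = 1) (L : ℕ) {A : Set ℝ}
    (hA : ∀ u : List ι, u.length = L → wMap r d u '' D ⊆ A ∨ ∀ x ∈ D, wMap r d u x ∉ A) :
    mC r d p D A ∈ VL p L := by
  induction L generalizing A with
  | zero =>
    rcases hA [] rfl with h1 | h1
    · right
      apply mC_one h hs
      intro x hx
      exact h1 ⟨x, hx, rfl⟩
    · left
      apply mC_zero hp
      intro x hx hxD
      exact h1 x hxD hx
  | succ L ih =>
    refine ⟨fun i => mC r d p D ((fun x => r i * x + d i) ⁻¹' A), ?_, (mC_step h hp hs A).symm⟩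
    intro i _
    apply ih
    intro u hu
    rcases hA (i :: u) (by simp [hu]) with h1 | h1
    · left
      rintro _ ⟨x, hx, rfl⟩
      exact h1 ⟨x, hx, rfl⟩
    · right
      intro x hx hx2
      exact h1 x hx hx2

theorem exists_q [Nonempty ι] (h : SInv r d D) : ∃ q, 0 < q ∧ q < 1 ∧ ∀ i, r i ≤ q := by
  obtain ⟨i, hi⟩ := Finite.exists_max r
  exact ⟨r i, h.pos i, h.lt i, hi⟩

theorem locate [Nonempty ι] (h : SInv r d D) {g : ℝ} (hg : 0 < g) (hG : Gap r d D g)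
    {A : Set ℝ} (hAD : A ⊆ D) {δ : ℝ} (hδ : 0 < δ) (hA : ∀ x ∈ A, ∀ y ∈ A, |x - y| ≤ δ) :
    ∃ w, A ⊆ wMap r d w '' D ∧ wProd r w * g ≤ δ := by
  by_contra hc
  push Not at hc
  have key : ∀ k : ℕ, ∃ w : List ι, w.length = k ∧ A ⊆ wMap r d w '' D := by
    intro k
    induction k with
    | zero => exact ⟨[], rfl, fun x hx => ⟨x, hAD hx, rfl⟩⟩
    | succ k ih =>
      obtain ⟨w, hw, hwA⟩ := ih
      have hlt := hc w hwA
      rcases A.eq_empty_or_nonempty with rfl | ⟨x, hx⟩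
      · exact ⟨List.replicate (k + 1) (Classical.arbitrary ι), by simp, by simp⟩
      · obtain ⟨x', hx', rfl⟩ := hwA hx
        obtain ⟨i, x'', hx'', rfl⟩ := h.surj x' hx'
        refine ⟨w ++ [i], by simp [hw], ?_⟩
        intro y hy
        obtain ⟨y', hy', rfl⟩ := hwA hy
        obtain ⟨j, y'', hy'', rfl⟩ := h.surj y' hy'
        by_cases hij : i = j
        · subst hij
          refine ⟨y'', hy'', ?_⟩
          rw [wMap_append]; rfl
        · exfalso
          have h1 := hG i j hij x'' hx'' y'' hy''
          have h2 := hA _ hx _ hy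
          rw [wMap_sub, abs_mul, abs_of_pos (wProd_pos h.pos w)] at h2
          have h3 := mul_le_mul_of_nonneg_left h1 (wProd_pos h.pos w).le
          linarith
  obtain ⟨q, hq0, hq1, hq⟩ := exists_q h
  obtain ⟨k, hk⟩ := exists_pow_lt_of_lt_one (div_pos hδ hg) hq1
  obtain ⟨w, hw, hwA⟩ := key k
  have h1 := hc w hwA
  have h2 := wProd_le_pow h.pos hq0.le hq w
  rw [hw] at h2
  rw [lt_div_iff₀ hg] at hk
  have := mul_le_mul_of_nonneg_right h2 hg.le
  linarith

theorem finite_ratios [Nonempty ι] (h : SInv r d D) (hp : ∀ i, 0 < p i) (hs : ∑ i, p i = 1)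
    {g : ℝ} (hg : 0 < g) (hG : Gap r d D g) {Λ : ℝ} (hΛ : 0 < Λ) :
    ∃ F : Set ℝ, F.Finite ∧ ∀ (A A' : Set ℝ) (η : ℝ), 0 < η → A ⊆ D → A' ⊆ A →
      (∀ x ∈ A, ∀ y ∈ A, |x - y| ≤ Λ * η) →
      (∀ x ∈ A, ∀ y ∈ D, y ∉ A → η ≤ |x - y|) →
      (∀ x ∈ A', ∀ y ∈ D, y ∉ A' → η ≤ |x - y|) →
      mC r d p D A' / mC r d p D A ∈ F := by
  obtain ⟨q, hq0, hq1, hq⟩ := exists_q h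
  obtain ⟨L, hL⟩ := exists_pow_lt_of_lt_one (div_pos hg hΛ) hq1
  refine ⟨Set.image2 (fun a b => a / b) (VL p L) (VL p L),
    (VL_finite p L).image2 _ (VL_finite p L), ?_⟩
  intro A A' η hη hAD hAA hdiam hsep hsep'
  obtain ⟨w, hw, hwg⟩ := locate h hg hG hAD (mul_pos hΛ hη) hdiam
  have aux : ∀ B : Set ℝ, B ⊆ A → (∀ x ∈ B, ∀ y ∈ D, y ∉ B → η ≤ |x - y|) →
      mC r d p D (wMap r d w ⁻¹' B) ∈ VL p L := by
    intro B hB hBs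
    apply mC_mem_VL h hp hs
    intro u hu
    by_contra hc
    push Not at hc
    obtain ⟨hc1, x, hx, hxB⟩ := hc
    apply hc1
    rintro _ ⟨y, hy, rfl⟩
    by_contra hyB
    have h1 := hBs _ hxB _ (h.wmaps w _ (h.wmaps u y hy)) hyB
    rw [wMap_sub, wMap_sub, ← mul_assoc, abs_mul,
      abs_of_pos (mul_pos (wProd_pos h.pos w) (wProd_pos h.pos u))] at h1
    have h2 : |x - y| ≤ 1 := by
      have := h.sub hx
      have := h.sub hy
      rw [abs_le]
      simp only [Set.mem_Icc] at *
      constructor <;> linarith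
    have h3 := wProd_le_pow h.pos hq0.le hq u
    rw [hu] at h3
    have hwp := wProd_pos h.pos w
    have hup := wProd_pos h.pos u
    have h4 : η ≤ wProd r w * wProd r u := by
      nlinarith [mul_pos hwp hup]
    have h5 : wProd r w * wProd r u < wProd r w * (g / Λ) :=
      mul_lt_mul_of_pos_left (h3.trans_lt hL) hwp
    have h6 : wProd r w * (g / Λ) ≤ η := by
      rw [← mul_div_assoc, div_le_iff₀ hΛ]; linarith
    linarith
  refine ⟨_, aux A' hAA hsep', _, aux A subset_rfl hsep, ?_⟩
  rw [mC_cyl h hp hs hg hG w (A := A) (fun x hx => hw hx.1),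
    mC_cyl h hp hs hg hG w (A := A') (fun x hx => hw (hAA hx.1))]
  have hpos := wProd_pos hp w
  simp only
  rw [mul_div_mul_left _ _ hpos.ne']

theorem mC_diam [Nonempty ι] (h : SInv r d D) {s : ℝ} (hs0 : 0 < s)
    (hs : ∑ i, r i ^ s = 1) {g : ℝ} (hg : 0 < g) (hG : Gap r d D g)
    {A : Set ℝ} {δ : ℝ} (hδ : 0 < δ) (hA : ∀ x ∈ A ∩ D, ∀ y ∈ A ∩ D, |x - y| ≤ δ) :
    mC r d (fun i => r i ^ s) D A ≤ (δ / g) ^ s := by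
  have hp : ∀ i, 0 < r i ^ s := fun i => Real.rpow_pos_of_pos (h.pos i) s
  obtain ⟨w, hw, hwg⟩ := locate h hg hG Set.inter_subset_right hδ hA
  rw [mC_cyl h hp hs hg hG w hw, wProd_rpow h.pos]
  have h1 : mC r d (fun i => r i ^ s) D (wMap r d w ⁻¹' A) ≤ 1 := by
    rw [← mC_one (p := fun i => r i ^ s) h hs (A := Set.univ) (Set.subset_univ _)]
    exact mC_mono h hp hs (Set.subset_univ _)
  have h2 : wProd r w ^ s ≤ (δ / g) ^ s := by
    apply Real.rpow_le_rpow (wProd_pos h.pos w).le _ hs0.le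
    rwa [le_div_iff₀ hg]
  have h3 : 0 < wProd r w ^ s := Real.rpow_pos_of_pos (wProd_pos h.pos w) s
  nlinarith
end content

section cover
set_option linter.unusedSectionVars false
variable {ι : Type*} [Fintype ι] {r t p : ι → ℝ} {T : Set ℝ} {ν : Set ℝ → ℝ} {H : ℝ}

/-- monotone subadditive set functions -/
structure SubAdd (ν : Set ℝ → ℝ) : Prop where
  empty : ν ∅ = 0
  mono : ∀ A B, A ⊆ B → ν A ≤ ν B
  union : ∀ A B, ν (A ∪ B) ≤ ν A + ν B

/-- uniform upper bound on all copies -/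
def Cov (ν : Set ℝ → ℝ) (r t p : ι → ℝ) (H : ℝ) (A : Set ℝ) (q : ℝ) : Prop :=
  ∀ v, ν (wMap r t v '' A) ≤ H * wProd p v * q

/-- upper bound on the set and its complement -/
def BiCov (ν : Set ℝ → ℝ) (r t p : ι → ℝ) (H : ℝ) (T A : Set ℝ) (q : ℝ) : Prop :=
  Cov ν r t p H A q ∧ Cov ν r t p H (T \ A) (1 - q)

theorem Cov.mono (hν : SubAdd ν) {A B : Set ℝ} {q : ℝ} (h : Cov ν r t p H B q) (hAB : A ⊆ B) :
    Cov ν r t p H A q := fun v => (hν.mono _ _ (Set.image_mono hAB)).trans (h v)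

theorem Cov.step {A : Set ℝ} {q : ℝ} (h : Cov ν r t p H A q) (i : ι) :
    Cov ν r t p H ((fun x => r i * x + t i) '' A) (p i * q) := by
  intro v
  have := h (v ++ [i])
  rw [wProd_append, wProd_cons, wProd_nil] at this
  have e : wMap r t v '' ((fun x => r i * x + t i) '' A) = wMap r t (v ++ [i]) '' A := by
    rw [Set.image_image]
    apply Set.image_congr
    intro x _
    rw [wMap_append]; rfl
  rw [e]
  linarith

theorem Cov.union (hν : SubAdd ν) {A B : Set ℝ} {q q' : ℝ} (h : Cov ν r t p H A q)
    (h' : Cov ν r t p H B q') : Cov ν r t p H (A ∪ B) (q + q') := by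
  intro v
  rw [Set.image_union, mul_add]
  exact (hν.union _ _).trans (add_le_add (h v) (h' v))

theorem Cov.biUnion (hν : SubAdd ν) (J : Finset ι) {A : ι → Set ℝ} {q : ι → ℝ}
    (h : ∀ i, Cov ν r t p H (A i) (q i)) :
    Cov ν r t p H (⋃ i ∈ J, A i) (∑ i ∈ J, q i) := by
  classical
  induction J using Finset.induction_on with
  | empty => intro v; simp [hν.empty]
  | insert a s ha ih =>
    rw [Finset.set_biUnion_insert, Finset.sum_insert ha]
    exact (h a).union hν ih

theorem BiCov.iUnion (hν : SubAdd ν) (hT : SInv r t T) (hs : ∑ i, p i = 1)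
    {A : ι → Set ℝ} {q : ι → ℝ} (h : ∀ i, BiCov ν r t p H T (A i) (q i)) :
    BiCov ν r t p H T (⋃ i, (fun x => r i * x + t i) '' A i) (∑ i, p i * q i) := by
  constructor
  · have := Cov.biUnion hν Finset.univ (fun i => (h i).1.step i)
    simpa using this
  · have := Cov.biUnion hν Finset.univ (fun i => (h i).2.step i)
    have e : ∑ i, p i * (1 - q i) = 1 - ∑ i, p i * q i := by
      simp only [mul_sub, mul_one, Finset.sum_sub_distrib, hs]
    rw [e] at this
    refine this.mono hν ?_
    rintro x ⟨hx, hxA⟩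
    obtain ⟨i, y, hy, rfl⟩ := hT.surj x hx
    simp only [Finset.mem_univ, Set.iUnion_true, Set.mem_iUnion]
    refine ⟨i, y, ⟨hy, fun hyA => hxA ?_⟩, rfl⟩
    exact Set.mem_iUnion.2 ⟨i, y, hyA, rfl⟩

theorem BiCov.empty (hν : SubAdd ν) (h : Cov ν r t p H T 1) : BiCov ν r t p H T ∅ 0 := by
  constructor
  · intro v; simp [hν.empty]
  · simpa using h

theorem BiCov.all (hν : SubAdd ν) (h : Cov ν r t p H T 1) : BiCov ν r t p H T T 1 := by
  constructor
  · exact h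
  · intro v; simp [hν.empty]

theorem BiCov.step (hν : SubAdd ν) (hT : SInv r t T) (hs : ∑ i, p i = 1) (h : Cov ν r t p H T 1)
    {A : Set ℝ} {q : ℝ} (hA : BiCov ν r t p H T A q) (e : ι) :
    BiCov ν r t p H T ((fun x => r e * x + t e) '' A) (p e * q) := by
  classical
  have := BiCov.iUnion hν hT hs (A := fun i => if i = e then A else ∅)
    (q := fun i => if i = e then q else 0) (H := H) (by
      intro i
      by_cases hi : i = e
      · simpa [hi] using hA
      · simpa [hi] using BiCov.empty hν h)
  convert this using 1
  · ext x
    simp only [Set.mem_iUnion]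
    constructor
    · intro hx; exact ⟨e, by simpa using hx⟩
    · rintro ⟨i, hi⟩
      by_cases hie : i = e
      · subst hie; simpa using hi
      · simp [hie] at hi
  · simp

theorem BiCov.two (hν : SubAdd ν) (hT : SInv r t T) (hs : ∑ i, p i = 1) (h : Cov ν r t p H T 1)
    {A B : Set ℝ} {q q' : ℝ} (hA : BiCov ν r t p H T A q) (hB : BiCov ν r t p H T B q')
    {e e' : ι} (he : e ≠ e') :
    BiCov ν r t p H T ((fun x => r e * x + t e) '' A ∪ (fun x => r e' * x + t e') '' B)
      (p e * q + p e' * q') := by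
  classical
  have := BiCov.iUnion hν hT hs (A := fun i => if i = e then A else if i = e' then B else ∅)
    (q := fun i => (if i = e then q else 0) + (if i = e' then q' else 0)) (H := H) (by
      intro i
      by_cases hi : i = e
      · subst hi; simpa [he] using hA
      · by_cases hi' : i = e'
        · simpa [hi', he.symm] using hB
        · simpa [hi, hi'] using BiCov.empty hν h)
  convert this using 1
  · ext x
    simp only [Set.mem_iUnion]
    constructor
    · rintro (hx | hx)
      · exact ⟨e, by simpa using hx⟩
      · exact ⟨e', by simpa [he.symm] using hx⟩
    · rintro ⟨i, hi⟩
      by_cases hie : i = e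
      · subst hie; left; simpa using hi
      · by_cases hie' : i = e'
        · subst hie'; right; simpa [he.symm] using hi
        · simp [hie, hie'] at hi
  · simp [mul_add, Finset.sum_add_distrib]

theorem BiCov.rep (hν : SubAdd ν) (hT : SInv r t T) (hs : ∑ i, p i = 1) (h : Cov ν r t p H T 1)
    {A : Set ℝ} {q : ℝ} (hA : BiCov ν r t p H T A q) (e : ι) (k : ℕ) :
    BiCov ν r t p H T (wMap r t (List.replicate k e) '' A) (p e ^ k * q) := by
  induction k with
  | zero => 
    have e : wMap r t (List.replicate 0 e) '' A = A := by
      simp only [List.replicate_zero, wMap, Set.image_id']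
    rw [e]; simpa using hA
  | succ k ih =>
    have := ih.step hν hT hs h e
    rw [Set.image_image] at this
    rw [pow_succ', mul_assoc]
    exact this

/-- Touching structure -/
structure TS (r t : ι → ℝ) (T : Set ℝ) (J : ι → Prop) (i0 i1 e0 e1 : ι) (a b : ℝ) : Prop where
  inv : SInv r t T
  zero : (0 : ℝ) ∈ T
  one : (1 : ℝ) ∈ T
  ord : ∀ i j, i ≠ j → r i + t i ≤ t j ∨ r j + t j ≤ t i
  he0 : t e0 = 0
  he1 : r e1 + t e1 = 1
  touch : r i0 + t i0 = t i1
  ne : i0 ≠ i1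
  ab : a < b
  ha : 0 ≤ a
  hb : b ≤ 1
  hJ : ∀ i, J i → b ≤ t i
  hJ' : ∀ i, ¬ J i → r i + t i ≤ a

variable {J : ι → Prop} {i0 i1 e0 e1 : ι} {a b : ℝ}

/-- the clopen neighbourhoods of the touching point -/
def CS (r t : ι → ℝ) (T : Set ℝ) (i0 i1 e0 e1 : ι) (a b : ℝ) (v : List ι) (k l : ℕ) : Set ℝ :=
  wMap r t (v ++ (i0 :: List.replicate k e1)) '' {x ∈ T | b ≤ x} ∪
  wMap r t (v ++ (i1 :: List.replicate l e0)) '' {x ∈ T | x ≤ a}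

theorem TS.dich (S : TS r t T J i0 i1 e0 e1 a b) {x : ℝ} (hx : x ∈ T) : x ≤ a ∨ b ≤ x := by
  obtain ⟨i, y, hy, rfl⟩ := S.inv.surj x hx
  have h1 := S.inv.sub hy
  have h2 := S.inv.pos i
  simp only [Set.mem_Icc] at h1
  by_cases hi : J i
  · right; have := S.hJ i hi; nlinarith
  · left; have := S.hJ' i hi; nlinarith

theorem TS.interior (S : TS r t T J i0 i1 e0 e1 a b) (w : List ι) {x : ℝ} (hx : x ∈ T)
    (h0 : wMap r t w 0 < x) (h1 : x < wMap r t w 1) : x ∈ wMap r t w '' T := by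
  induction w generalizing x with
  | nil => exact ⟨x, hx, rfl⟩
  | cons i u ih =>
    simp only [wMap] at h0 h1
    have u0 := S.inv.sub (S.inv.wmaps u 0 S.zero)
    have u1 := S.inv.sub (S.inv.wmaps u 1 S.one)
    simp only [Set.mem_Icc] at u0 u1
    have hri := S.inv.pos i
    obtain ⟨j, y, hy, rfl⟩ := S.inv.surj x hx
    have hy' := S.inv.sub hy
    simp only [Set.mem_Icc] at hy'
    have hrj := S.inv.pos j
    by_cases hij : i = j
    · subst hij
      obtain ⟨z, hz, hzy⟩ := ih hy (by nlinarith) (by nlinarith)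
      exact ⟨z, hz, by simp only [wMap]; rw [hzy]⟩
    · exfalso
      rcases S.ord i j hij with h | h
      · nlinarith
      · nlinarith

theorem wMap_rep_fix {e : ι} {x : ℝ} (h : r e * x + t e = x) (k : ℕ) :
    wMap r t (List.replicate k e) x = x := by
  induction k with
  | zero => rfl
  | succ k ih => rw [List.replicate_succ]; simp only [wMap]; rw [ih, h]

theorem TS.meet (S : TS r t T J i0 i1 e0 e1 a b) (v : List ι) (k l : ℕ) :
    wMap r t (v ++ (i0 :: List.replicate k e1)) 1 =
    wMap r t (v ++ (i1 :: List.replicate l e0)) 0 := by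
  rw [wMap_append, wMap_append]
  simp only [wMap]
  rw [wMap_rep_fix (by have := S.he1; linarith), wMap_rep_fix (by have := S.he0; linarith)]
  have := S.touch
  congr 1; linarith

theorem TS.bounds (S : TS r t T J i0 i1 e0 e1 a b) (v : List ι) (k l : ℕ) {x : ℝ}
    (hx : x ∈ CS r t T i0 i1 e0 e1 a b v k l) :
    wMap r t (v ++ (i0 :: List.replicate k e1)) b ≤ x ∧
    x ≤ wMap r t (v ++ (i1 :: List.replicate l e0)) a := by
  have hm := S.meet v k l
  rcases hx with ⟨y, ⟨hy, hby⟩, rfl⟩ | ⟨y, ⟨hy, hby⟩, rfl⟩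
  · refine ⟨wMap_le S.inv.pos t _ hby, ?_⟩
    calc _ ≤ _ := wMap_le S.inv.pos t _ (S.inv.sub hy).2
      _ = _ := hm
      _ ≤ _ := wMap_le S.inv.pos t _ S.ha
  · refine ⟨?_, wMap_le S.inv.pos t _ hby⟩
    calc _ ≤ _ := wMap_le S.inv.pos t _ S.hb
      _ = _ := hm
      _ ≤ _ := wMap_le S.inv.pos t _ (S.inv.sub hy).1

theorem TS.sep (S : TS r t T J i0 i1 e0 e1 a b) (v : List ι) (k l : ℕ) {x y : ℝ}
    (hx : x ∈ CS r t T i0 i1 e0 e1 a b v k l) (hy : y ∈ T)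
    (hyC : y ∉ CS r t T i0 i1 e0 e1 a b v k l) :
    wProd r (v ++ (i0 :: List.replicate k e1)) * (b - a) ≤ |x - y| ∨
    wProd r (v ++ (i1 :: List.replicate l e0)) * (b - a) ≤ |x - y| := by
  obtain ⟨h1, h2⟩ := S.bounds v k l hx
  have hm := S.meet v k l
  rw [← wMap_sub r t, ← wMap_sub r t]
  by_cases c1 : y ≤ wMap r t (v ++ (i0 :: List.replicate k e1)) a
  · left
    exact le_trans (by linarith) (le_abs_self _)
  by_cases c2 : wMap r t (v ++ (i1 :: List.replicate l e0)) b ≤ y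
  · right
    rw [abs_sub_comm]
    exact le_trans (by linarith) (le_abs_self _)
  exfalso
  push Not at c1 c2
  rcases lt_trichotomy y (wMap r t (v ++ (i0 :: List.replicate k e1)) 1) with h | h | h
  · obtain ⟨z, hz, rfl⟩ := S.interior _ hy
      (lt_of_le_of_lt (wMap_le S.inv.pos t _ S.ha) c1) h
    rw [wMap_lt_iff S.inv.pos] at c1
    rcases S.dich hz with hz' | hz'
    · linarith
    · exact hyC (Or.inl ⟨z, ⟨hz, hz'⟩, rfl⟩)
  · exact hyC (Or.inl ⟨1, ⟨S.one, S.hb⟩, h.symm⟩)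
  · rw [hm] at h
    obtain ⟨z, hz, rfl⟩ := S.interior _ hy h
      (lt_of_lt_of_le c2 (wMap_le S.inv.pos t _ S.hb))
    rw [wMap_lt_iff S.inv.pos] at c2
    rcases S.dich hz with hz' | hz'
    · exact hyC (Or.inr ⟨z, ⟨hz, hz'⟩, rfl⟩)
    · linarith

theorem TS.diam (S : TS r t T J i0 i1 e0 e1 a b) (v : List ι) (k l : ℕ) {x y : ℝ}
    (hx : x ∈ CS r t T i0 i1 e0 e1 a b v k l) (hy : y ∈ CS r t T i0 i1 e0 e1 a b v k l) :
    |x - y| ≤ wProd r (v ++ (i0 :: List.replicate k e1)) +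
      wProd r (v ++ (i1 :: List.replicate l e0)) := by
  obtain ⟨h1, h2⟩ := S.bounds v k l hx
  obtain ⟨h3, h4⟩ := S.bounds v k l hy
  have hm := S.meet v k l
  have g1 := wMap_sub r t (v ++ (i0 :: List.replicate k e1)) 1 b
  have g2 := wMap_sub r t (v ++ (i1 :: List.replicate l e0)) a 0
  have p1 := wProd_pos S.inv.pos (v ++ (i0 :: List.replicate k e1))
  have p2 := wProd_pos S.inv.pos (v ++ (i1 :: List.replicate l e0))
  have ha := S.ha
  have hb := S.hb
  have hab := S.ab
  have g3 : wProd r (v ++ (i0 :: List.replicate k e1)) * (1 - b) ≤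
    wProd r (v ++ (i0 :: List.replicate k e1)) := by nlinarith
  have g4 : wProd r (v ++ (i1 :: List.replicate l e0)) * (a - 0) ≤
    wProd r (v ++ (i1 :: List.replicate l e0)) := by nlinarith
  rw [abs_le]
  constructor <;> linarith

theorem TS.nested (S : TS r t T J i0 i1 e0 e1 a b) (v : List ι) (k l : ℕ) :
    CS r t T i0 i1 e0 e1 a b v (k + 1) l ⊆ CS r t T i0 i1 e0 e1 a b v k l := by
  apply Set.union_subset_union_left
  rintro _ ⟨x, ⟨hx, hbx⟩, rfl⟩
  refine ⟨r e1 * x + t e1, ⟨S.inv.maps e1 x hx, ?_⟩, ?_⟩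
  · have hJ : J e1 := by
      by_contra hc
      have := S.hJ' e1 hc
      have := S.he1
      have := S.ab
      have := S.hb
      linarith
    have h1 := S.hJ e1 hJ
    have h2 := S.inv.pos e1
    have h3 := (S.inv.sub hx).1
    nlinarith
  · rw [List.replicate_succ', ← List.cons_append, ← List.append_assoc,
      wMap_append r t (v ++ i0 :: List.replicate k e1) [e1]]
    rfl

theorem TS.wprod (k : ℕ) (v : List ι) (i e : ι) :
    wProd r (v ++ (i :: List.replicate k e)) = wProd r v * (r i * r e ^ k) := by
  rw [wProd_append, wProd_cons]; simp [wProd]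

theorem TS.CS_image (v : List ι) (k l : ℕ) :
    wMap r t v '' CS r t T i0 i1 e0 e1 a b [] k l = CS r t T i0 i1 e0 e1 a b v k l := by
  simp only [CS, Set.image_union, Set.image_image, List.nil_append]
  congr 1 <;> (apply Set.image_congr; intro x _; rw [wMap_append])

open Classical in
theorem TS.biCov (S : TS r t T J i0 i1 e0 e1 a b) (hν : SubAdd ν) (hs : ∑ i, p i = 1)
    (h : Cov ν r t p H T 1) (k l : ℕ) :
    BiCov ν r t p H T (CS r t T i0 i1 e0 e1 a b [] k l)
     (p i0 * (p e1 ^ k * ∑ i, p i * if J i then 1 else 0) +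
      p i1 * (p e0 ^ l * ∑ i, p i * if J i then 0 else 1)) := by
  have hR : BiCov ν r t p H T {x ∈ T | b ≤ x} (∑ i, p i * if J i then 1 else 0) := by
    have := BiCov.iUnion hν S.inv hs (A := fun i => if J i then T else ∅)
      (q := fun i => if J i then 1 else 0) (H := H) (by
      intro i
      by_cases hi : J i
      · simpa [hi] using BiCov.all hν h
      · simpa [hi] using BiCov.empty hν h)
    convert this using 1
    ext x
    simp only [Set.mem_iUnion]
    constructor
    · rintro ⟨hx, hbx⟩
      obtain ⟨i, y, hy, rfl⟩ := S.inv.surj x hx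
      have hi : J i := by
        by_contra hc
        have := S.hJ' i hc
        have := S.ab
        have := S.inv.pos i
        have := (S.inv.sub hy).2
        nlinarith
      exact ⟨i, y, by simpa [hi] using hy, rfl⟩
    · rintro ⟨i, y, hy, rfl⟩
      by_cases hi : J i
      · simp only [hi, if_true] at hy
        refine ⟨S.inv.maps i y hy, ?_⟩
        have := S.hJ i hi
        have := S.inv.pos i
        have := (S.inv.sub hy).1
        simp only
        nlinarith
      · simp [hi] at hy
  have hL : BiCov ν r t p H T {x ∈ T | x ≤ a} (∑ i, p i * if J i then 0 else 1) := by
    have := BiCov.iUnion hν S.inv hs (A := fun i => if J i then ∅ else T)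
      (q := fun i => if J i then 0 else 1) (H := H) (by
      intro i
      by_cases hi : J i
      · simpa [hi] using BiCov.empty hν h
      · simpa [hi] using BiCov.all hν h)
    convert this using 1
    ext x
    simp only [Set.mem_iUnion]
    constructor
    · rintro ⟨hx, hbx⟩
      obtain ⟨i, y, hy, rfl⟩ := S.inv.surj x hx
      have hi : ¬ J i := by
        intro hc
        have := S.hJ i hc
        have := S.ab
        have := S.inv.pos i
        have := (S.inv.sub hy).1
        nlinarith
      exact ⟨i, y, by simpa [hi] using hy, rfl⟩
    · rintro ⟨i, y, hy, rfl⟩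
      by_cases hi : J i
      · simp [hi] at hy
      · simp only [hi, if_false] at hy
        refine ⟨S.inv.maps i y hy, ?_⟩
        have := S.hJ' i hi
        have := S.inv.pos i
        have := (S.inv.sub hy).2
        simp only
        nlinarith
  have := BiCov.two hν S.inv hs h (hR.rep hν S.inv hs h e1 k) (hL.rep hν S.inv hs h e0 l) S.ne
  simp only [Set.image_image] at this
  exact this

theorem exists_H (hp : ∀ i, 0 < p i) {K : ℝ} (hK : ∀ v, ν (wMap r t v '' T) ≤ K * wProd p v)
    (h1 : 1 ≤ ν T) :
    ∃ H, 0 < H ∧ Cov ν r t p H T 1 ∧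
      ∀ ε, 0 < ε → ∃ v, (H - ε) * wProd p v ≤ ν (wMap r t v '' T) := by
  let f : List ι → ℝ := fun v => ν (wMap r t v '' T) / wProd p v
  have hbd : BddAbove (Set.range f) := by
    refine ⟨K, ?_⟩
    rintro _ ⟨v, rfl⟩
    simp only [f]
    rw [div_le_iff₀ (wProd_pos hp v)]
    exact hK v
  have hle : ∀ v, f v ≤ ⨆ v, f v := fun v => le_ciSup hbd v
  refine ⟨⨆ v, f v, ?_, ?_, ?_⟩
  · have := hle []
    have e : wMap r t [] '' T = T := by
      simp only [wMap, Set.image_id']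
    simp only [f, wProd_nil, div_one, e] at this
    simp only [f]
    linarith
  · intro v
    have := hle v
    simp only [f] at this
    rw [div_le_iff₀ (wProd_pos hp v)] at this
    rw [mul_one]
    exact this
  · intro ε hε
    obtain ⟨v, hv⟩ := exists_lt_of_lt_ciSup (show (⨆ v, f v) - ε < ⨆ v, f v by linarith)
    refine ⟨v, ?_⟩
    simp only [f] at hv
    rw [lt_div_iff₀ (wProd_pos hp v)] at hv
    exact hv.le

theorem BiCov.lower (hν : SubAdd ν) {A : Set ℝ} {q : ℝ}
    (hA : BiCov ν r t p H T A q)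
    {ε : ℝ} {v : List ι} (hv : (H - ε) * wProd p v ≤ ν (wMap r t v '' T)) :
    wProd p v * (H * q - ε) ≤ ν (wMap r t v '' A) := by
  have h1 := hA.2 v
  have h2 := hν.union (wMap r t v '' A) (wMap r t v '' (T \ A))
  have h3 := hν.mono (wMap r t v '' T) (wMap r t v '' A ∪ wMap r t v '' (T \ A)) (by
    rw [← Set.image_union]
    apply Set.image_mono
    intro x hx
    by_cases hxA : x ∈ A
    · exact Or.inl hxA
    · exact Or.inr ⟨hx, hxA⟩)
  nlinarith

end cover

section core
variable {ι : Type*} [Fintype ι] [Nonempty ι] {r d t : ι → ℝ} {D T : Set ℝ}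
  {J : ι → Prop} {i0 i1 e0 e1 : ι} {a b : ℝ}

theorem core (h : SInv r d D) (S : TS r t T J i0 i1 e0 e1 a b) {s : ℝ} (hs0 : 0 < s)
    (hs : ∑ i, r i ^ s = 1) {g : ℝ} (hg : 0 < g) (hG : Gap r d D g)
    {f : ℝ → ℝ} {c c' : ℝ} (hc : 0 < c) (hc' : 0 < c') (hf : ∀ x ∈ D, f x ∈ T)
    (hfc : ∀ x ∈ D, ∀ y ∈ D, c * |x - y| ≤ |f x - f y| ∧ |f x - f y| ≤ c' * |x - y|) :
    ∃ (x y : ℝ) (F : Set ℝ), 0 < x ∧ 0 < y ∧ F.Finite ∧ ∀ k l : ℕ, r e1 ^ k ≤ r e0 ^ l →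
      r e0 ^ (l + 1) < r e1 ^ k →
      (x * (r e1 ^ s) ^ (k + 1) + y * (r e0 ^ s) ^ l) /
        (x * (r e1 ^ s) ^ k + y * (r e0 ^ s) ^ l) ∈ F := by
  classical
  have hr := h.pos
  have hp : ∀ i, 0 < r i ^ s := fun i => Real.rpow_pos_of_pos (h.pos i) s
  set p : ι → ℝ := fun i => r i ^ s with hpdef
  set ν : Set ℝ → ℝ := fun A => mC r d p D (f ⁻¹' A) with hνdef
  have hν : SubAdd ν := by
    refine ⟨?_, ?_, ?_⟩
    · exact mC_zero hp (by simp)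
    · intro A B hAB
      exact mC_mono h hp hs (Set.inter_subset_left.trans (Set.preimage_mono hAB))
    · intro A B
      exact mC_union h hp hs _ _
  have hνT : ν T = 1 := mC_one h hs (fun x hx => hf x hx)
  have hK : ∀ v, ν (wMap r t v '' T) ≤ (1 / (c * g)) ^ s * wProd p v := by
    intro v
    have hv := wProd_pos hr v
    have h1 := mC_diam h hs0 hs hg hG (A := f ⁻¹' (wMap r t v '' T)) (δ := wProd r v / c)
      (div_pos hv hc) (by
        rintro x ⟨⟨x', hx', hxx⟩, hxD⟩ y ⟨⟨y', hy', hyy⟩, hyD⟩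
        have h2 := (hfc x hxD y hyD).1
        rw [← hxx, ← hyy, wMap_sub, abs_mul, abs_of_pos hv] at h2
        have h3 : |x' - y'| ≤ 1 := by
          have h4 := S.inv.sub hx'
          have h5 := S.inv.sub hy'
          simp only [Set.mem_Icc] at h4 h5
          rw [abs_le]
          constructor <;> linarith
        rw [le_div_iff₀ hc]
        nlinarith)
    refine h1.trans (le_of_eq ?_)
    rw [hpdef, wProd_rpow hr, ← Real.mul_rpow (by positivity) hv.le]
    congr 1
    field_simp
  obtain ⟨H, hH, hCov, hHε⟩ := exists_H hp hK hνT.ge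
  have hre0 := hr e0
  have hre1 := hr e1
  have hri0 := hr i0
  have hri1 := hr i1
  have hab : 0 < b - a := sub_pos.2 S.ab
  set κ := min (r i0 * r e1) (r i1) with hκ
  have hκ0 : 0 < κ := lt_min (mul_pos hri0 hre1) hri1
  set Λ := (1 + 1 / r e0) / c / ((b - a) * κ / c') with hΛ
  have hΛ0 : 0 < Λ := by positivity
  obtain ⟨F, hFfin, hF⟩ := finite_ratios (p := p) h hp hs hg hG hΛ0
  set mR : ℝ := ∑ i, p i * if J i then 1 else 0 with hmR
  set mL : ℝ := ∑ i, p i * if J i then 0 else 1 with hmL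
  have hmR0 : 0 < mR := by
    have hJ : J e1 := by
      by_contra hc
      have := S.hJ' e1 hc
      have := S.he1
      have := S.ab
      have := S.hb
      linarith
    apply Finset.sum_pos'
    · intro i _
      exact mul_nonneg (hp i).le (by split_ifs <;> norm_num)
    · exact ⟨e1, Finset.mem_univ _, by simpa [hJ] using hp e1⟩
  have hmL0 : 0 < mL := by
    have hJ : ¬ J e0 := by
      intro hc
      have := S.hJ e0 hc
      have := S.he0
      have := S.ab
      have := S.ha
      linarith
    apply Finset.sum_pos'
    · intro i _
      exact mul_nonneg (hp i).le (by split_ifs <;> norm_num)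
    · exact ⟨e0, Finset.mem_univ _, by simpa [hJ] using hp e0⟩
  refine ⟨p i0 * mR, p i1 * mL, F, mul_pos (hp i0) hmR0, mul_pos (hp i1) hmL0, hFfin, ?_⟩
  intro k l hkl hlk
  set M := p i0 * mR * p e1 ^ k + p i1 * mL * p e0 ^ l with hM
  set M' := p i0 * mR * p e1 ^ (k + 1) + p i1 * mL * p e0 ^ l with hM'
  change M' / M ∈ F
  have hM0 : 0 < M := add_pos (mul_pos (mul_pos (hp i0) hmR0) (pow_pos (hp e1) _))
    (mul_pos (mul_pos (hp i1) hmL0) (pow_pos (hp e0) _))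
  have hBC := S.biCov hν hs hCov k l
  have hBC' := S.biCov hν hs hCov (k + 1) l
  have eM : p i0 * (p e1 ^ k * mR) + p i1 * (p e0 ^ l * mL) = M := by rw [hM]; ring
  have eM' : p i0 * (p e1 ^ (k + 1) * mR) + p i1 * (p e0 ^ l * mL) = M' := by rw [hM']; ring
  rw [eM] at hBC
  rw [eM'] at hBC'
  have hin : ∀ v, ν (CS r t T i0 i1 e0 e1 a b v (k + 1) l) / ν (CS r t T i0 i1 e0 e1 a b v k l)
      ∈ F := by
    intro v
    have hv := wProd_pos hr v
    set θ := wProd r v * r e1 ^ k with hθ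
    have hθ0 : 0 < θ := mul_pos hv (pow_pos hre1 k)
    have hinter : ∀ B, mC r d p D (f ⁻¹' B ∩ D) = mC r d p D (f ⁻¹' B) := by
      intro B
      apply le_antisymm
      · exact mC_mono h hp hs (fun x hx => hx.1.1)
      · exact mC_mono h hp hs (fun x hx => hx)
    have w0 : wProd r (v ++ (i0 :: List.replicate k e1)) = θ * r i0 := by
      rw [TS.wprod, hθ]; ring
    have w0' : wProd r (v ++ (i0 :: List.replicate (k + 1) e1)) = θ * (r i0 * r e1) := by
      rw [TS.wprod, hθ]; ring
    have w1 : θ * r i1 ≤ wProd r (v ++ (i1 :: List.replicate l e0)) := by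
      rw [TS.wprod, hθ]
      have := mul_le_mul_of_nonneg_left hkl (mul_pos hv hri1).le
      linarith
    have w1' : wProd r (v ++ (i1 :: List.replicate l e0)) ≤ θ * (1 / r e0) := by
      rw [TS.wprod, hθ, mul_one_div, le_div_iff₀ hre0]
      rw [pow_succ] at hlk
      have h1 := mul_le_mul_of_nonneg_left hlk.le hv.le
      have h2 := (h.lt i1).le
      have h3 : 0 < wProd r v * (r e0 ^ l * r e0) := by positivity
      nlinarith
    have κ1 : κ ≤ r i0 * r e1 := min_le_left _ _
    have κ2 : κ ≤ r i1 := min_le_right _ _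
    have κ3 : κ ≤ r i0 := by
      have := (h.lt e1).le
      nlinarith
    have hη : 0 < θ * ((b - a) * κ / c') := by positivity
    have sepaux : ∀ k', (k' = k ∨ k' = k + 1) →
      ∀ x ∈ f ⁻¹' (CS r t T i0 i1 e0 e1 a b v k' l) ∩ D, ∀ y ∈ D,
        y ∉ f ⁻¹' (CS r t T i0 i1 e0 e1 a b v k' l) ∩ D → θ * ((b - a) * κ / c') ≤ |x - y| := by
      intro k' hk' x hx y hy hyn
      have h1 := (hfc x hx.2 y hy).2
      have h2 : f y ∉ CS r t T i0 i1 e0 e1 a b v k' l := fun hh => hyn ⟨hh, hy⟩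
      have h3 := S.sep v k' l hx.1 (hf y hy) h2
      have h4 : θ * ((b - a) * κ) ≤ |f x - f y| := by
        have hκa : ∀ z, κ ≤ z → θ * ((b - a) * κ) ≤ θ * z * (b - a) := by
          intro z hz
          have := mul_le_mul_of_nonneg_left hz (mul_pos hθ0 hab).le
          linarith
        rcases h3 with h3 | h3
        · rcases hk' with rfl | rfl
          · rw [w0] at h3
            exact (hκa _ κ3).trans h3
          · rw [w0'] at h3
            exact (hκa _ κ1).trans h3
        · refine le_trans (hκa _ κ2) (le_trans ?_ h3)
          exact mul_le_mul_of_nonneg_right w1 hab.le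
      rw [← mul_div_assoc, div_le_iff₀ hc']
      linarith
    have := hF (f ⁻¹' (CS r t T i0 i1 e0 e1 a b v k l) ∩ D)
      (f ⁻¹' (CS r t T i0 i1 e0 e1 a b v (k + 1) l) ∩ D) (θ * ((b - a) * κ / c')) hη
      Set.inter_subset_right
      (Set.inter_subset_inter_left _ (Set.preimage_mono (S.nested v k l)))
      (by
        intro x hx y hy
        have h1 := (hfc x hx.2 y hy.2).1
        have h2 := S.diam v k l hx.1 hy.1
        have e : Λ * (θ * ((b - a) * κ / c')) = θ * (1 + 1 / r e0) / c := by
          rw [hΛ]; field_simp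
        rw [e, le_div_iff₀ hc]
        have h3 := mul_le_mul_of_nonneg_left (h.lt i0).le hθ0.le
        rw [w0] at h2
        linarith)
      (sepaux k (Or.inl rfl)) (sepaux (k + 1) (Or.inr rfl))
    rw [hinter, hinter] at this
    exact this
  have hε : ∀ N : ℕ, (0 : ℝ) < 1 / ((N : ℝ) + 1) := fun N => by positivity
  choose v hv using fun N : ℕ => hHε _ (hε N)
  have hlim : ∀ (A : Set ℝ) (q : ℝ), BiCov ν r t p H T A q →
      Filter.Tendsto (fun N => ν (wMap r t (v N) '' A) / wProd p (v N)) Filter.atTop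
        (nhds (H * q)) := by
    intro A q hA
    have hl : Filter.Tendsto (fun N : ℕ => H * q - 1 / ((N : ℝ) + 1)) Filter.atTop
        (nhds (H * q)) := by
      simpa using tendsto_const_nhds.sub (tendsto_one_div_add_atTop_nhds_zero_nat (𝕜 := ℝ))
    refine tendsto_of_tendsto_of_tendsto_of_le_of_le hl tendsto_const_nhds ?_ ?_
    · intro N
      have := hA.lower hν (hv N)
      simp only
      rw [le_div_iff₀ (wProd_pos hp (v N))]
      linarith
    · intro N
      have := hA.1 (v N)
      simp only
      rw [div_le_iff₀ (wProd_pos hp (v N))]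
      linarith
  have hfin := (hlim _ _ hBC').div (hlim _ _ hBC) (mul_pos hH hM0).ne'
  rw [mul_div_mul_left _ _ hH.ne'] at hfin
  refine hFfin.isClosed.mem_of_tendsto hfin (Filter.Eventually.of_forall fun N => ?_)
  have hwp : wProd p (v N) ≠ 0 := (wProd_pos hp (v N)).ne'
  rw [Pi.div_apply, div_div_div_cancel_right₀ hwp, TS.CS_image, TS.CS_image]
  exact hin (v N)

theorem core_log {x y s q0 q1 : ℝ} {F : Set ℝ} (hx : 0 < x) (hy : 0 < y) (hs0 : 0 < s)
    (h0 : 0 < q0) (h0' : q0 < 1) (h1 : 0 < q1) (h1' : q1 < 1) (hF : F.Finite)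
    (h : ∀ k l : ℕ, q1 ^ k ≤ q0 ^ l → q0 ^ (l + 1) < q1 ^ k →
      (x * (q1 ^ s) ^ (k + 1) + y * (q0 ^ s) ^ l) /
        (x * (q1 ^ s) ^ k + y * (q0 ^ s) ^ l) ∈ F) :
    ∃ q : ℚ, Real.log q0 / Real.log q1 = (q : ℝ) := by
  have hex : ∀ k : ℕ, ∃ l : ℕ, q0 ^ (l + 1) < q1 ^ k ∧ q1 ^ k ≤ q0 ^ l := fun k =>
    exists_nat_pow_near_of_lt_one (pow_pos h1 k) (pow_le_one₀ h1.le h1'.le) h0 h0'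
  choose l hl hl' using hex
  set p0 := q0 ^ s with hp0
  set p1 := q1 ^ s with hp1
  have p0pos : 0 < p0 := Real.rpow_pos_of_pos h0 s
  have p1pos : 0 < p1 := Real.rpow_pos_of_pos h1 s
  have p1lt : p1 < 1 := Real.rpow_lt_one h1.le h1' hs0
  have hmaps : Set.MapsTo (fun k : ℕ => (x * p1 ^ (k + 1) + y * p0 ^ l k) /
        (x * p1 ^ k + y * p0 ^ l k)) Set.univ F := fun k _ => h k (l k) (hl' k) (hl k)
  obtain ⟨k, -, k', -, hne, heq⟩ := Set.infinite_univ.exists_ne_map_eq_of_mapsTo hmaps hF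
  have a1 : 0 < p1 ^ k := pow_pos p1pos k
  have a2 : 0 < p1 ^ k' := pow_pos p1pos k'
  have b1 : 0 < p0 ^ l k := pow_pos p0pos _
  have b2 : 0 < p0 ^ l k' := pow_pos p0pos _
  rw [div_eq_div_iff (by positivity) (by positivity)] at heq
  have key : p0 ^ l k * p1 ^ k' = p0 ^ l k' * p1 ^ k := by
    have h3 : (x * y * (1 - p1)) * (p0 ^ l k * p1 ^ k') =
        (x * y * (1 - p1)) * (p0 ^ l k' * p1 ^ k) := by
      rw [pow_succ, pow_succ] at heq
      linarith
    refine mul_left_cancel₀ ?_ h3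
    have : 0 < 1 - p1 := by linarith
    positivity
  have hlog := congrArg Real.log key
  rw [Real.log_mul b1.ne' a2.ne', Real.log_mul b2.ne' a1.ne', Real.log_pow, Real.log_pow,
    Real.log_pow, Real.log_pow, hp0, hp1, Real.log_rpow h0, Real.log_rpow h1] at hlog
  have L0 : Real.log q0 < 0 := Real.log_neg h0 h0'
  have L1 : Real.log q1 < 0 := Real.log_neg h1 h1'
  have hlin : ((l k : ℝ) - l k') * Real.log q0 = ((k : ℝ) - k') * Real.log q1 := by
    apply mul_left_cancel₀ hs0.ne'
    linarith
  have hkk : (k : ℝ) - k' ≠ 0 := by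
    rw [sub_ne_zero]; exact_mod_cast hne
  have hll : (l k : ℝ) - l k' ≠ 0 := by
    intro hz
    rw [hz, zero_mul] at hlin
    exact (mul_ne_zero hkk L1.ne) hlin.symm
  refine ⟨((k : ℚ) - k') / ((l k : ℚ) - l k'), ?_⟩
  push_cast
  rw [div_eq_div_iff L1.ne hll]
  linarith
end core

theorem exists_dim {n : ℕ} {ρ : ℕ → ℝ} (hρ : ContractionVec n ρ) :
    ∃ s : ℝ, 0 < s ∧ ∑ i : Fin n, ρ i ^ s = 1 := by
  have hpos : ∀ i : Fin n, 0 < ρ i := fun i => hρ.pos i i.2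
  have hcont : ContinuousOn (fun s : ℝ => ∑ i : Fin n, ρ i ^ s) (Set.Icc 0 1) := by
    apply Continuous.continuousOn
    exact continuous_finsetSum _ fun i _ => Real.continuous_const_rpow (hpos i).ne'
  have h3 := hρ.three_le
  have hn : (3 : ℝ) ≤ n := by exact_mod_cast h3
  have hsum : ∑ i : Fin n, ρ i < 1 := by
    have := hρ.sum_lt
    rwa [Finset.sum_range] at this
  have := intermediate_value_Icc' (zero_le_one) hcont
  obtain ⟨s, hs, hs1⟩ := this (show (1 : ℝ) ∈ Set.Icc _ _ by
    simp only [Real.rpow_one, Real.rpow_zero, Set.mem_Icc]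
    refine ⟨hsum.le, ?_⟩
    simp
    linarith)
  refine ⟨s, lt_of_le_of_ne hs.1 ?_, hs1⟩
  rintro rfl
  simp at hs1
  subst hs1
  omega

/-- monotone chain -/
theorem chain_le {n : ℕ} {ρ t : ℕ → ℝ} {g : ℝ} (hg : 0 ≤ g) (hpos : ∀ i, i < n → 0 < ρ i)
    (h : ∀ i, i + 1 < n → ρ i + t i + g ≤ t (i + 1)) {i j : ℕ} (hij : i < j) (hj : j < n) :
    ρ i + t i + g ≤ t j := by
  induction j, hij using Nat.le_induction with
  | base => exact h i hj
  | succ m hm ih =>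
    have h1 := ih (by omega)
    have h2 := h m hj
    have h3 := hpos m (by omega)
    linarith

theorem mk_inv {n : ℕ} {ρ t : ℕ → ℝ} (hρ : ContractionVec n ρ) {g : ℝ} (hg : 0 ≤ g)
    (h : ∀ i, i + 1 < n → ρ i + t i + g ≤ t (i + 1)) (h0 : t 0 = 0)
    (h1 : ρ (n - 1) + t (n - 1) = 1) {T : Set ℝ} (hT : IsCompact T) (hne : T.Nonempty)
    (hinv : T = ⋃ i ∈ Finset.range n, affMap ρ t i '' T) :
    SInv (fun i : Fin n => ρ i) (fun i : Fin n => t i) T ∧ (0 : ℝ) ∈ T ∧ (1 : ℝ) ∈ T := by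
  have hn := hρ.three_le
  have hmaps : ∀ i, i < n → ∀ x ∈ T, ρ i * x + t i ∈ T := by
    intro i hi x hx
    rw [hinv]
    simp only [Set.mem_iUnion, Finset.mem_range]
    exact ⟨i, hi, x, hx, rfl⟩
  have hsurj : ∀ x ∈ T, ∃ i, i < n ∧ ∃ y ∈ T, ρ i * y + t i = x := by
    intro x hx
    rw [hinv] at hx
    simp only [Set.mem_iUnion, Finset.mem_range] at hx
    obtain ⟨i, hi, y, hy, hxy⟩ := hx
    exact ⟨i, hi, y, hy, hxy⟩
  have hlo : ∀ i, i < n → 0 ≤ t i := by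
    intro i hi
    rcases Nat.eq_zero_or_pos i with rfl | hpos
    · rw [h0]
    · have := chain_le hg hρ.pos h hpos hi
      have := hρ.pos 0 (by omega)
      linarith
  have hhi : ∀ i, i < n → ρ i + t i ≤ 1 := by
    intro i hi
    rcases eq_or_ne i (n - 1) with rfl | hpos
    · rw [h1]
    · have := chain_le hg hρ.pos h (show i < n - 1 by omega) (by omega)
      have := hρ.pos (n - 1) (by omega)
      linarith
  obtain ⟨M, hM, hMub⟩ := hT.exists_isGreatest hne
  obtain ⟨m, hm, hmlb⟩ := hT.exists_isLeast hne
  have hM1 : M = 1 := by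
    apply le_antisymm
    · obtain ⟨i, hi, y, hy, hxy⟩ := hsurj M hM
      have := hMub hy
      have := hhi i hi
      have := hρ.pos i hi
      have := hρ.lt_one i hi
      nlinarith
    · have := hMub (hmaps (n - 1) (by omega) M hM)
      have := hρ.lt_one (n - 1) (by omega)
      nlinarith
  have hm0 : m = 0 := by
    apply le_antisymm
    · have := hmlb (hmaps 0 (by omega) m hm)
      have := hρ.lt_one 0 (by omega)
      nlinarith
    · obtain ⟨i, hi, y, hy, hxy⟩ := hsurj m hm
      have := hmlb hy
      have := hlo i hi
      have := hρ.pos i hi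
      have := hρ.lt_one i hi
      nlinarith
  subst hM1 hm0
  refine ⟨⟨fun i => hρ.pos i i.2, fun i => hρ.lt_one i i.2, fun x hx => ⟨hmlb hx, hMub hx⟩, hne,
    fun i x hx => hmaps i i.2 x hx, ?_⟩, hm, hM⟩
  intro x hx
  obtain ⟨i, hi, y, hy, hxy⟩ := hsurj x hx
  exact ⟨⟨i, hi⟩, y, hy, hxy⟩

theorem exists_gap {n : ℕ} {ρ t : ℕ → ℝ} (hρ : ContractionVec n ρ) (h0 : t 0 = 0)
    (h1 : ρ (n - 1) + t (n - 1) = 1) (h : ∀ i, i + 1 < n → ρ i + t i ≤ t (i + 1)) :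
    ∃ j, j + 1 < n ∧ ρ j + t j < t (j + 1) := by
  by_contra hc
  push Not at hc
  have hn := hρ.three_le
  have key : ∀ m, m < n → t m = ∑ i ∈ Finset.range m, ρ i := by
    intro m hm
    induction m with
    | zero => simpa using h0
    | succ m ih =>
      rw [Finset.sum_range_succ, ← ih (by omega)]
      have := hc m hm
      have := h m hm
      linarith
  have h2 := key (n - 1) (by omega)
  have h3 := hρ.sum_lt
  obtain ⟨m, rfl⟩ : ∃ m, n = m + 1 := ⟨n - 1, by omega⟩
  rw [Finset.sum_range_succ] at h3
  simp only [Nat.add_sub_cancel] at h1 h2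
  linarith

end helpers

/-- Theorem 1.1: if `D ∼ T` then `log ρ₁ / log ρₙ ∈ ℚ`. -/
theorem log_ratio_rational_of_lipEquiv {n : ℕ} {ρ : ℕ → ℝ}
    (hρ : ContractionVec n ρ) (S : TouchingIFS n ρ) (Q : DustIFS n ρ)
    (h : LipEquivOn Q.D S.T) :
    ∃ q : ℚ, Real.log (ρ 0) / Real.log (ρ (n - 1)) = (q : ℝ) := by
  have hn := hρ.three_le
  obtain ⟨s, hs0, hs⟩ := exists_dim hρ
  obtain ⟨f, c, c', hc, hcc, hbij, hlip⟩ := h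
  set g : ℝ := (1 - ∑ j ∈ Finset.range n, ρ j) / (n - 1) with hg
  have hg0 : 0 < g := by
    apply div_pos
    · linarith [hρ.sum_lt]
    · have : (3 : ℝ) ≤ n := by exact_mod_cast hn
      linarith
  have hdo : ∀ i, i + 1 < n → ρ i + Q.d i + g ≤ Q.d (i + 1) := by
    intro i hi
    have := Q.equal_gap i hi
    simp only [affMap, mul_one, mul_zero, zero_add] at this
    linarith
  have hd0 : Q.d 0 = 0 := by simpa [affMap] using Q.left0
  have hd1 : ρ (n - 1) + Q.d (n - 1) = 1 := by simpa [affMap] using Q.right1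
  obtain ⟨hD, -, -⟩ := mk_inv hρ hg0.le hdo hd0 hd1 Q.compactD Q.nonemptyD Q.invD
  have hG : Gap (fun i : Fin n => ρ i) (fun i : Fin n => Q.d i) Q.D g := by
    have key : ∀ i j : Fin n, i < j → ∀ x ∈ Q.D, ∀ y ∈ Q.D,
        g ≤ (ρ j * y + Q.d j) - (ρ i * x + Q.d i) := by
      intro i j hij x hx y hy
      have h1 := chain_le hg0.le hρ.pos hdo (show (i : ℕ) < j from hij) j.2
      have h2 := (hD.sub hx).2
      have h3 := (hD.sub hy).1
      have h4 := hρ.pos i i.2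
      have h5 := hρ.pos j j.2
      nlinarith
    intro i j hij x hx y hy
    rcases lt_or_gt_of_ne hij with hlt | hlt
    · rw [abs_sub_comm]
      exact (key i j hlt x hx y hy).trans (le_abs_self _)
    · exact (key j i hlt y hy x hx).trans (le_abs_self _)
  have hto : ∀ i, i + 1 < n → ρ i + S.t i ≤ S.t (i + 1) := by
    intro i hi
    have := S.order i hi
    simpa [affMap] using this
  have hto' : ∀ i, i + 1 < n → ρ i + S.t i + 0 ≤ S.t (i + 1) := by
    intro i hi
    simpa using hto i hi
  have ht0 : S.t 0 = 0 := by simpa [affMap] using S.left0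
  have ht1 : ρ (n - 1) + S.t (n - 1) = 1 := by simpa [affMap] using S.right1
  obtain ⟨hT, hT0, hT1⟩ := mk_inv hρ le_rfl hto' ht0 ht1 S.compactT S.nonemptyT S.invT
  obtain ⟨i, hi, htouch⟩ := S.touch_ex
  simp only [affMap, mul_one, mul_zero, zero_add] at htouch
  obtain ⟨j, hj, hgap⟩ := exists_gap hρ ht0 ht1 hto
  have hchain : ∀ i k, i < k → k < n → ρ i + S.t i ≤ S.t k := by
    intro i k hik hk
    have := chain_le le_rfl hρ.pos hto' hik hk
    linarith
  have hTS : TS (fun i : Fin n => ρ i) (fun i : Fin n => S.t i) S.T (fun i => j < (i : ℕ))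
      ⟨i, by omega⟩ ⟨i + 1, hi⟩ ⟨0, by omega⟩ ⟨n - 1, by omega⟩ (ρ j + S.t j) (S.t (j + 1)) := by
    refine ⟨hT, hT0, hT1, ?_, ht0, ht1, htouch, ?_, hgap, ?_, ?_, ?_, ?_⟩
    · intro i k hik
      rcases lt_or_gt_of_ne hik with hlt | hlt
      · exact Or.inl (hchain i k hlt k.2)
      · exact Or.inr (hchain k i hlt i.2)
    · intro he
      have := congrArg Fin.val he
      simp at this
    · have h1 := hT.maps ⟨j, by omega⟩ 1 hT1
      have := (hT.sub h1).1
      simpa using this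
    · have h1 := hT.maps ⟨j + 1, hj⟩ 0 hT0
      have := (hT.sub h1).2
      simpa using this
    · intro k hk
      rcases Nat.lt_or_ge (j + 1) k with hlt | hge
      · have h1 := hchain (j + 1) k hlt k.2
        have := hρ.pos (j + 1) hj
        linarith
      · have : (k : ℕ) = j + 1 := by omega
        simp only [this, le_refl]
    · intro k hk
      rcases Nat.lt_or_ge k j with hlt | hge
      · have h1 := hchain k j hlt (by omega)
        have := hρ.pos j (by omega)
        linarith
      · have : (k : ℕ) = j := by omega
        simp only [this, le_refl]
  have : Nonempty (Fin n) := ⟨⟨0, by omega⟩⟩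
  obtain ⟨x, y, F, hx, hy, hF, hmem⟩ := core hD hTS hs0 hs hg0 hG hc (hc.trans_le hcc)
    (fun x hx => hbij.mapsTo hx)
    (fun x hx y hy => by simpa only [Real.dist_eq] using hlip x hx y hy)
  exact core_log hx hy hs0 (hρ.pos 0 (by omega)) (hρ.lt_one 0 (by omega))
    (hρ.pos (n - 1) (by omega)) (hρ.lt_one (n - 1) (by omega)) hF hmem
end
end

section
/- Let n = 4, ρ₁ = ρ₄, and suppose only the second and third intervals touch (Σ_T = {2}). Let s be the common Hausdorff dimension of D and T and μᵢ = ρᵢ^s. If D and T are Lipschitz equivalent, then μ₂ and μ₃ are algebraically dependent over ℚ: there exists a nonzero polynomial P ∈ ℚ[x,y] with P(μ₂,μ₃) = 0. -/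
noncomputable section

open Set Metric MeasureTheory

variable {n : ℕ} {ρ : ℕ → ℝ}

namespace FB

/-- Word map. -/
def W (r t : Fin 4 → ℝ) : List (Fin 4) → ℝ → ℝ
  | [], x => x
  | i :: w, x => r i * W r t w x + t i

/-- Product weight of a word in a monoid. -/
def sc {M : Type*} [Monoid M] (r : Fin 4 → M) (w : List (Fin 4)) : M := (w.map r).prod

section sc
variable {M : Type*} [Monoid M] (r : Fin 4 → M)
lemma sc_nil : sc r [] = 1 := by simp [sc]
lemma sc_cons (i w) : sc r (i :: w) = r i * sc r w := by simp [sc]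
lemma sc_append (u v) : sc r (u ++ v) = sc r u * sc r v := by simp [sc]
lemma sc_singleton (i) : sc r [i] = r i := by simp [sc]
end sc

/-- All words of length `N`. -/
def wds (N : ℕ) : Finset (List (Fin 4)) := (List.finite_length_eq (Fin 4) N).toFinset

lemma mem_wds {N : ℕ} {w : List (Fin 4)} : w ∈ wds N ↔ w.length = N := by simp [wds]

variable {r t : Fin 4 → ℝ}

lemma sc_pos (hr : ∀ i, 0 < r i) (w) : 0 < sc r w := by
  induction w with
  | nil => simp [sc]
  | cons i w ih => rw [sc_cons]; exact mul_pos (hr i) ih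

lemma sc_le_pow (hr : ∀ i, 0 < r i) {θ : ℝ} (hθ : ∀ i, r i ≤ θ) (w) :
    sc r w ≤ θ ^ w.length := by
  induction w with
  | nil => simp [sc]
  | cons i w ih =>
    rw [sc_cons, List.length_cons, pow_succ']
    exact mul_le_mul (hθ i) ih (sc_pos hr w).le ((hr i).le.trans (hθ i))

lemma sc_rpow (hr : ∀ i, 0 < r i) (s : ℝ) (w) :
    sc (fun i => r i ^ s) w = sc r w ^ s := by
  induction w with
  | nil => simp [sc]
  | cons i w ih =>
    rw [sc_cons, sc_cons, ih, Real.mul_rpow (hr i).le (sc_pos hr w).le]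

lemma W_append (u v x) : W r t (u ++ v) x = W r t u (W r t v x) := by
  induction u with
  | nil => rfl
  | cons i w ih => simp only [List.cons_append, W, ih]

lemma W_sub (w x y) : W r t w x - W r t w y = sc r w * (x - y) := by
  induction w with
  | nil => simp [W, sc]
  | cons i w ih => simp only [W, sc_cons]; linear_combination r i * ih

lemma W_affine (w) : W r t w = fun x => sc r w * x + W r t w 0 := by
  funext x; have := W_sub (r := r) (t := t) w x 0; linarith

lemma W_abs (hr : ∀ i, 0 < r i) (w x y) : |W r t w x - W r t w y| = sc r w * |x - y| := by
  rw [W_sub, abs_mul, abs_of_pos (sc_pos hr w)]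

lemma W_inj (hr : ∀ i, 0 < r i) (w) : Function.Injective (W r t w) := by
  intro x y h
  have := W_sub (r := r) (t := t) w x y
  rw [h, sub_self] at this
  have h2 := (sc_pos hr w).ne'
  have : x - y = 0 := by
    rcases mul_eq_zero.1 this.symm with h | h
    · exact absurd h h2
    · exact h
  linarith

lemma W_cont (w) : Continuous (W r t w) := by
  rw [W_affine]; fun_prop

/-- Sum over words of length `N+1`. -/
lemma wds_succ (N : ℕ) : wds (N + 1) =
    ((Finset.univ : Finset (Fin 4)) ×ˢ wds N).image (fun p => p.1 :: p.2) := by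
  ext w
  simp only [mem_wds, Finset.mem_image, Finset.mem_product, Finset.mem_univ, true_and, Prod.exists]
  constructor
  · intro h
    cases w with
    | nil => simp at h
    | cons i w => exact ⟨i, w, by simpa using h, rfl⟩
  · rintro ⟨i, w', h, rfl⟩; simp [h]

lemma sum_wds (m : Fin 4 → ℝ) (hm : ∑ i, m i = 1) (N : ℕ) : ∑ w ∈ wds N, sc m w = 1 := by
  induction N with
  | zero =>
    have : wds 0 = {[]} := by ext w; simp [mem_wds]
    rw [this]; simp [sc]
  | succ N ih =>
    rw [wds_succ, Finset.sum_image (by rintro ⟨a, b⟩ _ ⟨c, d⟩ _ h; simpa using h),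
      Finset.sum_product]
    simp only [sc_cons, ← Finset.mul_sum, ih, mul_one, hm]

/-- `A` is a union of `δ`-chains in `E`. -/
def Sat (E A : Set ℝ) (δ : ℝ) : Prop := A ⊆ E ∧ ∀ x ∈ A, ∀ y ∈ E, |x - y| < δ → y ∈ A

lemma sat_finite {E : Set ℝ} (hE : E ⊆ Icc 0 1) {δ : ℝ} (hδ : 0 < δ) :
    {A | Sat E A δ}.Finite := by
  -- a saturated set is determined by the cells it meets
  let c : ℝ → ℤ := fun x => ⌊x / δ⌋
  have key : ∀ x y, c x = c y → |x - y| < δ := by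
    intro x y h
    have := Int.abs_sub_lt_one_of_floor_eq_floor h
    rw [← sub_div, abs_div, abs_of_pos hδ, div_lt_one hδ] at this
    exact this
  have hfin : (Set.Icc (0:ℤ) ⌊1/δ⌋).Finite := Set.finite_Icc _ _
  have : Set.InjOn (fun A : Set ℝ => c '' A) {A | Sat E A δ} := by
    intro A hA B hB h
    simp only at h
    ext x
    constructor
    · intro hx
      have : c x ∈ c '' B := h ▸ mem_image_of_mem c hx
      obtain ⟨y, hy, hxy⟩ := this
      exact hB.2 y hy x (hA.1 hx) (key _ _ hxy)
    · intro hx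
      have : c x ∈ c '' A := h ▸ mem_image_of_mem c hx
      obtain ⟨y, hy, hxy⟩ := this
      exact hA.2 y hy x (hB.1 hx) (key _ _ hxy)
  refine Set.Finite.of_finite_image (hfin.finite_subsets.subset ?_) this
  rintro _ ⟨A, hA, rfl⟩
  rintro _ ⟨x, hx, rfl⟩
  have := hE (hA.1 hx)
  refine ⟨Int.floor_nonneg.2 (div_nonneg this.1 hδ.le), Int.floor_le_floor ?_⟩
  exact div_le_div_of_nonneg_right this.2 hδ.le

/-- Hausdorff measure of an affine image. -/
lemma haus_affine {s : ℝ} (hs : 0 ≤ s) {a : ℝ} (ha : 0 < a) (b : ℝ) (A : Set ℝ) :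
    (μH[s] ((fun x => a * x + b) '' A)) = ENNReal.ofReal (a ^ s) * μH[s] A := by
  have h1 : (fun x => a * x + b) '' A = (fun x => x + b) '' ((fun x => a • x) '' A) := by
    rw [image_image]; simp
  have h2 : Isometry (fun x : ℝ => x + b) := isometry_add_right b
  rw [h1, h2.hausdorffMeasure_image (Or.inl hs), image_smul,
    Measure.hausdorffMeasure_smul₀ hs ha.ne']
  rw [ENNReal.smul_def, smul_eq_mul]
  congr 1
  rw [← ENNReal.ofReal_rpow_of_pos ha, ENNReal.coe_rpow_of_nonneg _ hs]
  congr 1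
  rw [ENNReal.ofReal, Real.toNNReal_eq_nnnorm_of_nonneg ha.le]

lemma haus_W {s : ℝ} (hs : 0 ≤ s) (hr : ∀ i, 0 < r i) (w) (A : Set ℝ) :
    μH[s] (W r t w '' A) = ENNReal.ofReal (sc r w ^ s) * μH[s] A := by
  rw [W_affine]; exact haus_affine hs (sc_pos hr w) _ A

/-- invariant set facts -/
lemma cyl_sub {X : Set ℝ} (hX : X = ⋃ i, (fun x => r i * x + t i) '' X) (w) :
    W r t w '' X ⊆ X := by
  induction w with
  | nil => simp [W]
  | cons i w ih =>
    rintro _ ⟨x, hx, rfl⟩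
    rw [hX]
    exact mem_iUnion.2 ⟨i, W r t w x, ih ⟨x, hx, rfl⟩, rfl⟩

lemma cyl_append_sub {X : Set ℝ} (hX : X = ⋃ i, (fun x => r i * x + t i) '' X) (w u) :
    W r t (w ++ u) '' X ⊆ W r t w '' X := by
  rintro _ ⟨x, hx, rfl⟩
  rw [W_append]
  exact ⟨_, cyl_sub hX u ⟨x, hx, rfl⟩, rfl⟩

lemma cyl_exists {X : Set ℝ} (hX : X = ⋃ i, (fun x => r i * x + t i) '' X) (N : ℕ) :
    ∀ z ∈ X, ∃ u : List (Fin 4), u.length = N ∧ z ∈ W r t u '' X := by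
  induction N with
  | zero => intro z hz; exact ⟨[], rfl, z, hz, rfl⟩
  | succ N ih =>
    intro z hz
    rw [hX] at hz
    obtain ⟨i, y, hy, rfl⟩ := mem_iUnion.1 hz
    obtain ⟨u, hu, x, hx, rfl⟩ := ih y hy
    exact ⟨i :: u, by simp [hu], x, hx, rfl⟩

lemma cyl_exists' {X : Set ℝ} (hX : X = ⋃ i, (fun x => r i * x + t i) '' X) (N : ℕ) (w)
    (z) (hz : z ∈ W r t w '' X) :
    ∃ u : List (Fin 4), u.length = N ∧ z ∈ W r t (w ++ u) '' X := by
  obtain ⟨y, hy, rfl⟩ := hz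
  obtain ⟨u, hu, x, hx, rfl⟩ := cyl_exists hX N y hy
  exact ⟨u, hu, x, hx, by rw [W_append]⟩

/-- The attractor lies in `[0,1]`. -/
lemma sub_unit {X : Set ℝ} (hX : X = ⋃ i, (fun x => r i * x + t i) '' X) (hc : IsCompact X)
    (hne : X.Nonempty) (hr : ∀ i, 0 < r i) (hr1 : ∀ i, r i < 1) (h0 : ∀ i, 0 ≤ t i)
    (h1 : ∀ i, t i + r i ≤ 1) : X ⊆ Icc 0 1 := by
  obtain ⟨M, hM, hMx⟩ := hc.exists_isGreatest hne
  obtain ⟨m, hm, hmx⟩ := hc.exists_isLeast hne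
  have hM1 : M ≤ 1 := by
    have := hM
    rw [hX] at this
    obtain ⟨i, y, hy, hy2⟩ := mem_iUnion.1 this
    simp only at hy2
    have := hMx hy
    by_contra hcon
    push Not at hcon
    nlinarith [hr i, hr1 i, h1 i, mul_le_mul_of_nonneg_left this (hr i).le]
  have hm1 : 0 ≤ m := by
    have := hm
    rw [hX] at this
    obtain ⟨i, y, hy, hy2⟩ := mem_iUnion.1 this
    simp only at hy2
    have := hmx hy
    by_contra hcon
    push Not at hcon
    nlinarith [hr i, hr1 i, h0 i, mul_le_mul_of_nonneg_left this (hr i).le]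
  intro x hx
  exact ⟨hm1.trans (hmx hx), (hMx hx).trans hM1⟩

lemma exists_pow_small {θ : ℝ} (h1 : θ < 1) {δ : ℝ} (hδ : 0 < δ) :
    ∃ N : ℕ, θ ^ N < δ := exists_pow_lt_of_lt_one hδ h1

end FB

namespace FB
open scoped ENNReal NNReal Topology
open Filter

variable {r t : Fin 4 → ℝ}

/-- Separation of first level pieces. -/
def Sep (r t : Fin 4 → ℝ) (D : Set ℝ) (g : ℝ) : Prop :=
  ∀ i j, i ≠ j → ∀ x ∈ D, ∀ y ∈ D, g ≤ |(r i * x + t i) - (r j * y + t j)|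

lemma sat_cyl {D : Set ℝ} (hD : D = ⋃ i, (fun x => r i * x + t i) '' D) {g : ℝ} (hg : 0 < g)
    (hsep : Sep r t D g) (hr : ∀ i, 0 < r i) (hr1 : ∀ i, r i < 1) (w) :
    Sat D (W r t w '' D) (g * sc r w) := by
  refine ⟨cyl_sub hD w, ?_⟩
  induction w with
  | nil => intro x _ y hy _; exact ⟨y, hy, rfl⟩
  | cons i w ih =>
    rintro _ ⟨x, hx, rfl⟩ y hy hxy
    rw [hD] at hy
    obtain ⟨j, y, hy', rfl⟩ := mem_iUnion.1 hy
    simp only [W, sc_cons] at hxy ⊢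
    have hle : sc r w ≤ 1 := by simpa using sc_le_pow hr (fun i => (hr1 i).le) w
    by_cases hij : i = j
    · subst hij
      have e : r i * W r t w x + t i - (r i * y + t i) = r i * (W r t w x - y) := by ring
      rw [e, abs_mul, abs_of_pos (hr i)] at hxy
      have : |W r t w x - y| < g * sc r w := by
        have := hr i
        by_contra hcon
        push Not at hcon
        nlinarith [mul_le_mul_of_nonneg_left hcon this.le]
      obtain ⟨z, hz, hz2⟩ := ih _ ⟨x, hx, rfl⟩ y hy' this
      exact ⟨z, hz, by simp only [hz2]⟩
    · exfalso
      have h1 := hsep i j hij _ (cyl_sub hD w ⟨x, hx, rfl⟩) y hy'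
      have h2 : r i * sc r w ≤ 1 := by
        nlinarith [hr i, hr1 i, sc_pos hr w]
      nlinarith

lemma cyl_disj {D : Set ℝ} (hD : D = ⋃ i, (fun x => r i * x + t i) '' D) {g : ℝ} (hg : 0 < g)
    (hsep : Sep r t D g) (hr : ∀ i, 0 < r i) (u : List (Fin 4)) :
    ∀ v : List (Fin 4), u.length = v.length → u ≠ v →
      Disjoint (W r t u '' D) (W r t v '' D) := by
  induction u with
  | nil => intro v h h2; cases v <;> simp at *
  | cons i u ih =>
    intro v h h2
    cases v with
    | nil => simp at h
    | cons j v =>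
      rw [Set.disjoint_left]
      rintro _ ⟨x, hx, rfl⟩ ⟨y, hy, hxy⟩
      simp only [W] at hxy
      by_cases hij : i = j
      · subst hij
        have h3 : W r t v y = W r t u x := by
          have := (hr i).ne'
          have h4 : r i * W r t v y = r i * W r t u x := by linarith
          exact mul_left_cancel₀ this h4
        have := ih v (by simpa using h) (by rintro rfl; exact h2 rfl)
        exact Set.disjoint_left.1 this ⟨x, hx, rfl⟩ ⟨y, hy, h3⟩
      · have := hsep i j hij _ (cyl_sub hD u ⟨x, hx, rfl⟩) _ (cyl_sub hD v ⟨y, hy, rfl⟩)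
        rw [hxy, sub_self, abs_zero] at this
        linarith

lemma cyl_disj' {D : Set ℝ} (hD : D = ⋃ i, (fun x => r i * x + t i) '' D) {g : ℝ} (hg : 0 < g)
    (hsep : Sep r t D g) (hr : ∀ i, 0 < r i) (w u v : List (Fin 4))
    (h : u.length = v.length) (h2 : u ≠ v) :
      Disjoint (W r t (w ++ u) '' D) (W r t (w ++ v) '' D) :=
  cyl_disj hD hg hsep hr _ _ (by simp [h]) (by simpa using h2)

/-- Finiteness of the Hausdorff measure. -/
lemma haus_finite {D : Set ℝ} (hD : D = ⋃ i, (fun x => r i * x + t i) '' D)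
    (h01 : D ⊆ Icc 0 1) (hr : ∀ i, 0 < r i) {θ : ℝ} (hθ : ∀ i, r i ≤ θ) (hθ1 : θ < 1)
    {s : ℝ} (hs : 0 < s) (hsum : ∑ i, r i ^ s = 1) : μH[s] D ≤ 1 := by
  have hθ0 : 0 < θ := (hr 0).trans_le (hθ 0)
  have hdiam : ∀ w, ediam (W r t w '' D) ≤ ENNReal.ofReal (sc r w) := by
    intro w
    apply ediam_le
    rintro _ ⟨x, hx, rfl⟩ _ ⟨y, hy, rfl⟩
    rw [edist_dist, Real.dist_eq, W_abs hr]
    apply ENNReal.ofReal_le_ofReal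
    have h1 := h01 hx
    have h2 := h01 hy
    have : |x - y| ≤ 1 := by rw [abs_le]; constructor <;> linarith [h1.1, h1.2, h2.1, h2.2]
    nlinarith [sc_pos hr w]
  have := Measure.hausdorffMeasure_le_liminf_sum (X := ℝ) (ι := fun N : ℕ => ↥(wds N)) s D
    (l := atTop) (fun N => ENNReal.ofReal (θ ^ N)) (by
      have h := tendsto_pow_atTop_nhds_zero_of_lt_one hθ0.le hθ1
      have := ENNReal.tendsto_ofReal h
      simpa using this)
    (fun N w => W r t w.1 '' D)
    (Eventually.of_forall (fun N w => (hdiam _).trans (ENNReal.ofReal_le_ofReal (by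
      have := sc_le_pow hr hθ w.1
      rwa [mem_wds.1 w.2] at this))))
    (Eventually.of_forall (fun N z hz => by
      obtain ⟨u, hu, hz⟩ := cyl_exists hD N z hz
      exact mem_iUnion.2 ⟨⟨u, mem_wds.2 hu⟩, hz⟩))
  refine this.trans ?_
  have hle : ∀ N : ℕ, ∑ w : ↥(wds N), ediam (W r t w.1 '' D) ^ s ≤ 1 := by
    intro N
    calc ∑ w : ↥(wds N), ediam (W r t w.1 '' D) ^ s
        ≤ ∑ w : ↥(wds N), ENNReal.ofReal (sc (fun i => r i ^ s) w.1) := by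
          apply Finset.sum_le_sum
          intro w _
          rw [sc_rpow hr, ← ENNReal.ofReal_rpow_of_pos (sc_pos hr _)]
          exact ENNReal.rpow_le_rpow (hdiam _) hs.le
      _ = ENNReal.ofReal (∑ w : ↥(wds N), sc (fun i => r i ^ s) w.1) := by
          rw [ENNReal.ofReal_sum_of_nonneg]
          intro w _
          exact (sc_pos (fun i => Real.rpow_pos_of_pos (hr i) s) _).le
      _ = 1 := by
          rw [Finset.sum_coe_sort (wds N) (fun w => sc (fun i => r i ^ s) w), sum_wds _ hsum]
          simp
  calc _ ≤ liminf (fun _ : ℕ => (1:ℝ≥0∞)) atTop :=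
        liminf_le_liminf (Eventually.of_forall hle)
    _ = 1 := by simp

/-- Approximating graphs of the distribution function. -/
def Gam (r t m o : Fin 4 → ℝ) (D : Set ℝ) : ℕ → Set (ℝ × ℝ)
  | 0 => D ×ˢ Icc 0 1
  | N + 1 => ⋃ i, (fun p : ℝ × ℝ => (r i * p.1 + t i, m i * p.2 + o i)) '' Gam r t m o D N

variable {m o : Fin 4 → ℝ}

lemma gam_compact {D : Set ℝ} (hc : IsCompact D) (N) : IsCompact (Gam r t m o D N) := by
  induction N with
  | zero => exact hc.prod isCompact_Icc
  | succ N ih =>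
    apply isCompact_iUnion
    intro i
    exact ih.image (by fun_prop)

lemma gam_anti {D : Set ℝ} (hD : D = ⋃ i, (fun x => r i * x + t i) '' D)
    (ho : ∀ i, ∀ y ∈ Icc (0:ℝ) 1, m i * y + o i ∈ Icc (0:ℝ) 1) (N) :
    Gam r t m o D (N + 1) ⊆ Gam r t m o D N := by
  induction N with
  | zero =>
    intro p hp
    obtain ⟨i, q, hq, rfl⟩ := mem_iUnion.1 hp
    refine ⟨?_, ho i _ hq.2⟩
    rw [hD]
    exact mem_iUnion.2 ⟨i, _, hq.1, rfl⟩
  | succ N ih =>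
    intro p hp
    obtain ⟨i, q, hq, rfl⟩ := mem_iUnion.1 hp
    exact mem_iUnion.2 ⟨i, q, ih hq, rfl⟩

lemma gam_sub {D : Set ℝ} (hD : D = ⋃ i, (fun x => r i * x + t i) '' D)
    (ho : ∀ i, ∀ y ∈ Icc (0:ℝ) 1, m i * y + o i ∈ Icc (0:ℝ) 1) (N) :
    Gam r t m o D N ⊆ D ×ˢ Icc 0 1 := by
  induction N with
  | zero => exact Subset.rfl
  | succ N ih => exact (gam_anti hD ho N).trans ih

lemma gam_surj {D : Set ℝ} (hne : D.Nonempty)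
    (hcov : ∀ y ∈ Icc (0:ℝ) 1, ∃ i, ∃ z ∈ Icc (0:ℝ) 1, y = m i * z + o i) (N) :
    ∀ y ∈ Icc (0:ℝ) 1, ∃ x, (x, y) ∈ Gam r t m o D N := by
  induction N with
  | zero => intro y hy; obtain ⟨x, hx⟩ := hne; exact ⟨x, hx, hy⟩
  | succ N ih =>
    intro y hy
    obtain ⟨i, z, hz, rfl⟩ := hcov y hy
    obtain ⟨x, hx⟩ := ih z hz
    exact ⟨r i * x + t i, mem_iUnion.2 ⟨i, (x, z), hx, rfl⟩⟩

lemma gam_holder {D : Set ℝ} (hD : D = ⋃ i, (fun x => r i * x + t i) '' D)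
    (ho : ∀ i, ∀ y ∈ Icc (0:ℝ) 1, m i * y + o i ∈ Icc (0:ℝ) 1) {g : ℝ} (hg : 0 < g)
    (hsep : Sep r t D g) (hr : ∀ i, 0 < r i) {s : ℝ} (hs : 0 < s) (hm : ∀ i, m i = r i ^ s)
    {θ : ℝ} (hθ : ∀ i, m i ≤ θ) (N) :
    ∀ p ∈ Gam r t m o D N, ∀ q ∈ Gam r t m o D N,
      |p.2 - q.2| ≤ (|p.1 - q.1| / g) ^ s + θ ^ N := by
  induction N with
  | zero =>
    intro p hp q hq
    have h1 := hp.2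
    have h2 := hq.2
    have : |p.2 - q.2| ≤ 1 := by rw [abs_le]; constructor <;> linarith [h1.1, h1.2, h2.1, h2.2]
    have : 0 ≤ (|p.1 - q.1| / g) ^ s := by positivity
    simp; linarith
  | succ N ih =>
    intro p hp q hq
    have hp' := gam_sub hD ho _ hp
    have hq' := gam_sub hD ho _ hq
    obtain ⟨i, p, hpp, rfl⟩ := mem_iUnion.1 hp
    obtain ⟨j, q, hqq, rfl⟩ := mem_iUnion.1 hq
    have hθ0 : 0 ≤ θ := le_trans (by rw [hm 0]; have := hr 0; positivity) (hθ 0)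
    by_cases hij : i = j
    · subst hij
      have h := ih p hpp q hqq
      simp only
      have e1 : m i * p.2 + o i - (m i * q.2 + o i) = m i * (p.2 - q.2) := by ring
      have e2 : r i * p.1 + t i - (r i * q.1 + t i) = r i * (p.1 - q.1) := by ring
      have hmi : 0 < m i := by rw [hm]; exact Real.rpow_pos_of_pos (hr i) s
      rw [e1, e2, abs_mul, abs_mul, abs_of_pos hmi, abs_of_pos (hr i), mul_div_assoc,
        Real.mul_rpow (hr i).le (by positivity), ← hm i, pow_succ']
      calc m i * |p.2 - q.2| ≤ m i * ((|p.1 - q.1| / g) ^ s + θ ^ N) := by gcongr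
        _ ≤ _ := by
          rw [mul_add]
          gcongr
          exact hθ i
    · have h1 := hp'.2
      have h2 := hq'.2
      simp only at h1 h2 ⊢
      have h3 : |m i * p.2 + o i - (m j * q.2 + o j)| ≤ 1 := by
        rw [abs_le]; constructor <;> linarith [h1.1, h1.2, h2.1, h2.2]
      have h4 := hsep i j hij p.1 (gam_sub hD ho _ hpp).1 q.1 (gam_sub hD ho _ hqq).1
      have h5 : 1 ≤ (|r i * p.1 + t i - (r j * q.1 + t j)| / g) ^ s := by
        apply Real.one_le_rpow _ hs.le
        rwa [le_div_iff₀ hg, one_mul]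
      have : 0 ≤ θ ^ (N + 1) := by positivity
      linarith

/-- Positivity of the Hausdorff measure. -/
lemma haus_pos {D : Set ℝ} (hD : D = ⋃ i, (fun x => r i * x + t i) '' D) (hc : IsCompact D)
    (hne : D.Nonempty) {g : ℝ} (hg : 0 < g)
    (hsep : Sep r t D g) (hr : ∀ i, 0 < r i) {θ : ℝ} (hθ : ∀ i, r i ≤ θ) (hθ1 : θ < 1)
    {s : ℝ} (hs : 0 < s) (hsum : ∑ i, r i ^ s = 1) : μH[s] D ≠ 0 := by
  have hθ0 : 0 < θ := (hr 0).trans_le (hθ 0)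
  set m : Fin 4 → ℝ := fun i => r i ^ s with hm
  have hmpos : ∀ i, 0 < m i := fun i => Real.rpow_pos_of_pos (hr i) s
  have hsum4 : m 0 + m 1 + m 2 + m 3 = 1 := by rw [← hsum, Fin.sum_univ_four]
  let o : Fin 4 → ℝ := ![0, m 0, m 0 + m 1, m 0 + m 1 + m 2]
  have ho : ∀ i, ∀ y ∈ Icc (0:ℝ) 1, m i * y + o i ∈ Icc (0:ℝ) 1 := by
    intro i y hy
    have h0 := hmpos 0
    have h1 := hmpos 1
    have h2 := hmpos 2
    have h3 := hmpos 3
    have hyl := hy.1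
    have hyr := hy.2
    have := mul_nonneg (hmpos i).le hyl
    have := mul_le_mul_of_nonneg_left hyr (hmpos i).le
    fin_cases i <;> simp [o] at * <;> constructor <;> linarith
  have hcov : ∀ y ∈ Icc (0:ℝ) 1, ∃ i, ∃ z ∈ Icc (0:ℝ) 1, y = m i * z + o i := by
    intro y hy
    have key : ∀ i, o i ≤ y → y ≤ o i + m i → ∃ i, ∃ z ∈ Icc (0:ℝ) 1, y = m i * z + o i := by
      intro i h1 h2
      refine ⟨i, (y - o i) / m i, ⟨div_nonneg (by linarith) (hmpos i).le, ?_⟩, ?_⟩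
      · rw [div_le_one (hmpos i)]; linarith
      · have := (hmpos i).ne'
        field_simp
        ring
    have k0 := key 0
    have k1 := key 1
    have k2 := key 2
    have k3 := key 3
    simp only [o, Matrix.cons_val] at k0 k1 k2 k3
    rcases le_total y (m 0) with h | h
    · exact k0 hy.1 (by linarith)
    rcases le_total y (m 0 + m 1) with h' | h'
    · exact k1 h (by linarith)
    rcases le_total y (m 0 + m 1 + m 2) with h'' | h''
    · exact k2 h' (by linarith)
    · exact k3 h'' (by linarith [hy.2])
  -- a point over each `y`
  have hex : ∀ y ∈ Icc (0:ℝ) 1, ∃ x, ∀ N, (x, y) ∈ Gam r t m o D N := by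
    intro y hy
    have hne' : (⋂ N, (Gam r t m o D N ∩ (univ ×ˢ {y}))).Nonempty := by
      apply IsCompact.nonempty_iInter_of_sequence_nonempty_isCompact_isClosed
      · intro N
        exact inter_subset_inter_left _ (gam_anti hD ho N)
      · intro N
        obtain ⟨x, hx⟩ := gam_surj (r := r) (t := t) hne hcov N y hy
        exact ⟨(x, y), hx, by simp⟩
      · exact (gam_compact hc 0).inter_right (isClosed_univ.prod isClosed_singleton)
      · intro N
        exact ((gam_compact hc N).isClosed).inter (isClosed_univ.prod isClosed_singleton)
    obtain ⟨⟨x, y'⟩, hp⟩ := hne'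
    rw [mem_iInter] at hp
    have : y' = y := by simpa using (hp 0).2
    subst this
    exact ⟨x, fun N => (hp N).1⟩
  have hhol : ∀ p q : ℝ × ℝ, (∀ N, p ∈ Gam r t m o D N) → (∀ N, q ∈ Gam r t m o D N) →
      |p.2 - q.2| ≤ (|p.1 - q.1| / g) ^ s := by
    intro p q hp hq
    have h1 : ∀ N : ℕ, |p.2 - q.2| ≤ (|p.1 - q.1| / g) ^ s + (θ ^ s) ^ N := fun N =>
      gam_holder hD ho hg hsep hr hs (fun i => rfl)
        (fun i => Real.rpow_le_rpow (hr i).le (hθ i) hs.le) N p (hp N) q (hq N)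
    have h2 : Tendsto (fun N : ℕ => (|p.1 - q.1| / g) ^ s + (θ ^ s) ^ N) atTop
        (𝓝 ((|p.1 - q.1| / g) ^ s + 0)) :=
      tendsto_const_nhds.add (tendsto_pow_atTop_nhds_zero_of_lt_one (by positivity)
        (Real.rpow_lt_one hθ0.le hθ1 hs))
    rw [add_zero] at h2
    exact ge_of_tendsto' h2 h1
  let R : Set (ℝ × ℝ) := {p | ∀ N, p ∈ Gam r t m o D N}
  let D' : Set ℝ := Prod.fst '' R
  have hD' : D' ⊆ D := by
    rintro _ ⟨p, hp, rfl⟩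
    exact (hp 0).1
  have : ∃ F : ℝ → ℝ, ∀ x ∈ D', (x, F x) ∈ R := by
    have : ∀ x, ∃ y, x ∈ D' → (x, y) ∈ R := by
      intro x
      by_cases hx : x ∈ D'
      · obtain ⟨⟨a, b⟩, hp, rfl⟩ := hx
        exact ⟨b, fun _ => hp⟩
      · exact ⟨0, fun h => absurd h hx⟩
    choose F hF using this
    exact ⟨F, hF⟩
  obtain ⟨F, hF⟩ := this
  have himg : Icc (0:ℝ) 1 ⊆ F '' D' := by
    intro y hy
    obtain ⟨x, hx⟩ := hex y hy
    refine ⟨x, ⟨(x, y), hx, rfl⟩, ?_⟩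
    have := hhol (x, F x) (x, y) (hF x ⟨(x, y), hx, rfl⟩) hx
    simp only [sub_self, abs_zero, zero_div, Real.zero_rpow hs.ne'] at this
    have := abs_nonpos_iff.1 this
    linarith
  have hH : HolderOnWith (Real.toNNReal ((1 / g) ^ s)) (Real.toNNReal s) F D' := by
    intro x hx y hy
    have h := hhol (x, F x) (y, F y) (hF x hx) (hF y hy)
    simp only at h
    rw [Real.coe_toNNReal _ hs.le, edist_dist, edist_dist, Real.dist_eq, Real.dist_eq,
      ENNReal.ofReal_rpow_of_nonneg (abs_nonneg _) hs.le]
    change _ ≤ ENNReal.ofReal _ * _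
    rw [← ENNReal.ofReal_mul (by positivity)]
    apply ENNReal.ofReal_le_ofReal
    rw [← Real.mul_rpow (by positivity) (abs_nonneg _)]
    convert h using 2
    ring
  have h1 := hH.hausdorffMeasure_image_le (by simpa using hs) (d := 1) zero_le_one
  rw [Real.coe_toNNReal _ hs.le, mul_one] at h1
  intro h0
  have h2 : μH[s] D' = 0 := measure_mono_null hD' h0
  rw [h2, mul_zero, hausdorffMeasure_real] at h1
  have h3 := (measure_mono himg).trans h1
  simp at h3

end FB

namespace FB

variable {r t : Fin 4 → ℝ} {T : Set ℝ}

/-- The touching four branch system, only the branches 1 and 2 touch. -/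
structure Tch (r t : Fin 4 → ℝ) (T : Set ℝ) : Prop where
  pos : ∀ i, 0 < r i
  r03 : r 0 = r 3
  t0 : t 0 = 0
  g01 : r 0 < t 1
  tch : t 1 + r 1 = t 2
  g23 : t 2 + r 2 < t 3
  e1 : t 3 + r 3 = 1
  comp : IsCompact T
  ne : T.Nonempty
  inv : T = ⋃ i, (fun x => r i * x + t i) '' T

/-- The middle part. -/
def Cm (r t : Fin 4 → ℝ) (T : Set ℝ) : Set ℝ := W r t [1] '' T ∪ W r t [2] '' T

/-- Contraction about the touching point. -/
def hk (r t : Fin 4 → ℝ) (k : ℕ) (y : ℝ) : ℝ := t 2 + r 0 ^ k * (y - t 2)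

/-- The shrinking pieces around the touching point. -/
def Ck (r t : Fin 4 → ℝ) (T : Set ℝ) (k : ℕ) : Set ℝ := hk r t k '' Cm r t T

/-- Saturated, away from the end points. -/
def IntSat (T A : Set ℝ) : Prop := ∃ δ > 0, A ⊆ Icc δ (1 - δ) ∧ Sat T A δ

namespace Tch

lemma sum_lt (h : Tch r t T) : r 0 + r 1 + r 2 + r 3 < 1 := by
  have := h.g01; have := h.tch; have := h.g23; have := h.e1
  linarith

lemma le_sum (h : Tch r t T) (i) : r i ≤ r 0 + r 1 + r 2 + r 3 := by
  have h0 := h.pos 0; have h1 := h.pos 1; have h2 := h.pos 2; have h3 := h.pos 3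
  fin_cases i <;> simp <;> linarith

lemma lt_one (h : Tch r t T) (i) : r i < 1 := (h.le_sum i).trans_lt h.sum_lt

lemma t_nonneg (h : Tch r t T) (i) : 0 ≤ t i := by
  have h0 := h.pos 0; have h1 := h.pos 1; have h2 := h.pos 2; have h3 := h.pos 3
  have := h.t0; have := h.g01; have := h.tch; have := h.g23; have := h.e1
  fin_cases i <;> simp <;> linarith

lemma t_le (h : Tch r t T) (i) : t i + r i ≤ 1 := by
  have h0 := h.pos 0; have h1 := h.pos 1; have h2 := h.pos 2; have h3 := h.pos 3
  have := h.t0; have := h.g01; have := h.tch; have := h.g23; have := h.e1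
  fin_cases i <;> simp <;> linarith

lemma unit (h : Tch r t T) : T ⊆ Icc 0 1 := sub_unit h.inv h.comp h.ne h.pos h.lt_one h.t_nonneg h.t_le

lemma cases (h : Tch r t T) {z} (hz : z ∈ T) : ∃ i, ∃ y ∈ T, z = r i * y + t i := by
  rw [h.inv] at hz
  obtain ⟨i, y, hy, rfl⟩ := mem_iUnion.1 hz
  exact ⟨i, y, hy, rfl⟩

lemma mem (h : Tch r t T) (i) {y} (hy : y ∈ T) : r i * y + t i ∈ T := by
  rw [h.inv]; exact mem_iUnion.2 ⟨i, y, hy, rfl⟩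

lemma bd (h : Tch r t T) (i) {y} (hy : y ∈ T) : t i ≤ r i * y + t i ∧ r i * y + t i ≤ t i + r i := by
  have h1 := h.unit hy
  have := h.pos i
  constructor <;> nlinarith [h1.1, h1.2]

lemma zero_mem (h : Tch r t T) : (0:ℝ) ∈ T := by
  obtain ⟨m, hm, hmx⟩ := h.comp.exists_isLeast h.ne
  have h1 := hmx (h.mem 0 hm)
  have h2 := (h.unit hm).1
  have h3 := h.lt_one 0
  rw [h.t0] at h1
  have : m = 0 := by nlinarith
  exact this ▸ hm

lemma C_sub (h : Tch r t T) : Cm r t T ⊆ T := by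
  rintro _ (hx | hx)
  · exact cyl_sub h.inv _ hx
  · exact cyl_sub h.inv _ hx

lemma C_iff {y} : y ∈ Cm r t T ↔ (∃ z ∈ T, y = r 1 * z + t 1) ∨ ∃ z ∈ T, y = r 2 * z + t 2 := by
  simp only [Cm, mem_union, mem_image, W]
  constructor
  · rintro (⟨z, hz, rfl⟩ | ⟨z, hz, rfl⟩)
    · exact Or.inl ⟨z, hz, rfl⟩
    · exact Or.inr ⟨z, hz, rfl⟩
  · rintro (⟨z, hz, rfl⟩ | ⟨z, hz, rfl⟩)
    · exact Or.inl ⟨z, hz, rfl⟩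
    · exact Or.inr ⟨z, hz, rfl⟩

lemma C_bd (h : Tch r t T) {y} (hy : y ∈ Cm r t T) : t 2 - r 1 ≤ y ∧ y ≤ t 2 + r 2 := by
  have := h.tch
  have h1 := h.pos 1; have h2 := h.pos 2
  rcases C_iff.1 hy with ⟨z, hz, rfl⟩ | ⟨z, hz, rfl⟩
  · have := h.bd 1 hz; constructor <;> linarith
  · have := h.bd 2 hz; constructor <;> linarith

lemma hk_mem (h : Tch r t T) (k) {y} (hy : y ∈ Cm r t T) : hk r t k y ∈ Cm r t T := by
  have ht := h.tch
  induction k with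
  | zero => simpa [hk] using hy
  | succ k ih =>
    have e : hk r t (k + 1) y = t 2 + r 0 * (hk r t k y - t 2) := by simp [hk]; ring
    rw [e]
    generalize hk r t k y = y at ih
    rcases C_iff.1 ih with ⟨z, hz, rfl⟩ | ⟨z, hz, rfl⟩
    · refine C_iff.2 (Or.inl ⟨_, h.mem 3 hz, ?_⟩)
      rw [← ht, ← h.r03]
      have : t 3 = 1 - r 0 := by have := h.e1; have := h.r03; linarith
      rw [this]; ring
    · refine C_iff.2 (Or.inr ⟨_, h.mem 0 hz, ?_⟩)
      rw [h.t0]; ring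

lemma Ck_sub_C (h : Tch r t T) (k) : Ck r t T k ⊆ Cm r t T := by
  rintro _ ⟨y, hy, rfl⟩; exact h.hk_mem k hy

lemma tp_mem (h : Tch r t T) (k) : t 2 ∈ Ck r t T k :=
  ⟨t 2, C_iff.2 (Or.inr ⟨0, h.zero_mem, by simp⟩), by simp [hk]⟩

lemma split1 (h : Tch r t T) : ∃ e > 0, ∀ y ∈ Cm r t T, y ∈ Ck r t T 1 ∨ y ≤ t 2 - (r 1 * r 0 + e) ∨
    t 2 + (r 2 * r 0 + e) ≤ y := by
  have h0 := h.pos 0; have h1 := h.pos 1; have h2 := h.pos 2; have h3 := h.pos 3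
  have q1 := h.t0; have q2 := h.g01; have q3 := h.tch; have q4 := h.g23; have q5 := h.e1
  have q6 := h.r03
  refine ⟨min (r 1 * (t 3 - t 2 - r 2)) (r 2 * (t 1 - r 0)), by
    apply lt_min <;> apply mul_pos <;> linarith, ?_⟩
  intro y hy
  have m1 := min_le_left (r 1 * (t 3 - t 2 - r 2)) (r 2 * (t 1 - r 0))
  have m2 := min_le_right (r 1 * (t 3 - t 2 - r 2)) (r 2 * (t 1 - r 0))
  set e := min (r 1 * (t 3 - t 2 - r 2)) (r 2 * (t 1 - r 0))
  rcases C_iff.1 hy with ⟨z, hz, rfl⟩ | ⟨z, hz, rfl⟩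
  · obtain ⟨j, z, hz', rfl⟩ := h.cases hz
    have hb := h.bd j hz'
    by_cases hj : j = 3
    · subst hj
      left
      refine ⟨r 1 * z + t 1, C_iff.2 (Or.inl ⟨z, hz', rfl⟩), ?_⟩
      simp only [hk, pow_one]
      have : t 3 = 1 - r 0 := by linarith
      rw [← q3, this, ← q6]; ring
    · right; left
      have : r j * z + t j ≤ t 2 + r 2 := by
        refine hb.2.trans ?_
        fin_cases j <;> simp at * <;> linarith
      have := mul_le_mul_of_nonneg_left this h1.le
      have e3 : t 3 = 1 - r 0 := by linarith
      rw [e3] at m1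
      nlinarith
  · obtain ⟨j, z, hz', rfl⟩ := h.cases hz
    have hb := h.bd j hz'
    by_cases hj : j = 0
    · subst hj
      left
      refine ⟨r 2 * z + t 2, C_iff.2 (Or.inr ⟨z, hz', rfl⟩), ?_⟩
      simp only [hk, pow_one]
      rw [q1]; ring
    · right; right
      have : t 1 ≤ r j * z + t j := by
        refine le_trans ?_ hb.1
        fin_cases j <;> simp at * <;> linarith
      have := mul_le_mul_of_nonneg_left this h2.le
      nlinarith

lemma intSat_C (h : Tch r t T) : IntSat T (Cm r t T) := by
  have h0 := h.pos 0; have h1 := h.pos 1; have h2 := h.pos 2; have h3 := h.pos 3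
  have q1 := h.t0; have q2 := h.g01; have q3 := h.tch; have q4 := h.g23; have q5 := h.e1
  have m1 := min_le_left (t 1 - r 0) (t 3 - t 2 - r 2)
  have m2 := min_le_right (t 1 - r 0) (t 3 - t 2 - r 2)
  refine ⟨min (t 1 - r 0) (t 3 - t 2 - r 2), lt_min (by linarith) (by linarith), ?_,
    h.C_sub, ?_⟩
  · intro y hy
    have := h.C_bd hy
    constructor <;> linarith
  · intro x hx y hy hxy
    have hb := h.C_bd hx
    obtain ⟨j, z, hz, rfl⟩ := h.cases hy
    have hb' := h.bd j hz
    rw [abs_lt] at hxy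
    generalize min (t 1 - r 0) (t 3 - t 2 - r 2) = e at *
    fin_cases j
    · exfalso; simp at *; linarith
    · exact C_iff.2 (Or.inl ⟨z, hz, rfl⟩)
    · exact C_iff.2 (Or.inr ⟨z, hz, rfl⟩)
    · exfalso; simp at *; linarith

lemma intSat_Ck (h : Tch r t T) (k) : IntSat T (Ck r t T k) := by
  have h0 := h.pos 0
  induction k with
  | zero =>
    have : Ck r t T 0 = Cm r t T := by
      have : hk r t 0 = id := by funext y; simp [hk]
      simp [Ck, this]
    rw [this]; exact h.intSat_C
  | succ k ih =>
    obtain ⟨e, he, hsp⟩ := h.split1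
    obtain ⟨δ, hδ, hI, hS⟩ := ih
    have hp : 0 < r 0 ^ k := by positivity
    have hsub : Ck r t T (k + 1) ⊆ Ck r t T k := by
      rintro _ ⟨y, hy, rfl⟩
      refine ⟨hk r t 1 y, h.hk_mem 1 hy, ?_⟩
      simp only [hk]; ring
    refine ⟨min δ (r 0 ^ k * e), lt_min hδ (by positivity), ?_, hsub.trans hS.1, ?_⟩
    · intro x hx
      have := hI (hsub hx)
      have := min_le_left δ (r 0 ^ k * e)
      constructor <;> linarith [this, (hI (hsub hx)).1, (hI (hsub hx)).2]
    · intro x hx y hy hxy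
      have hy2 := hS.2 x (hsub hx) y hy (hxy.trans_le (min_le_left _ _))
      have hxy2 := abs_lt.1 (hxy.trans_le (min_le_right _ _))
      obtain ⟨c, hc, rfl⟩ := hx
      have hcb := h.C_bd hc
      obtain ⟨d, hd, rfl⟩ := hy2
      simp only [hk, pow_succ] at hxy2
      rcases hsp d hd with hd1 | hd1 | hd1
      · obtain ⟨d', hd', rfl⟩ := hd1
        refine ⟨d', hd', ?_⟩
        simp only [hk]; ring
      · exfalso
        have : r 0 * (c - t 2) - (d - t 2) < e := by
          have h5 := hxy2.2
          have h6 : r 0 ^ k * (r 0 * (c - t 2) - (d - t 2)) < r 0 ^ k * e := by linarith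
          exact lt_of_mul_lt_mul_left h6 hp.le
        nlinarith [mul_le_mul_of_nonneg_left hcb.1 h0.le]
      · exfalso
        have : -e < r 0 * (c - t 2) - (d - t 2) := by
          have h5 := hxy2.1
          have h6 : r 0 ^ k * (-e) < r 0 ^ k * (r 0 * (c - t 2) - (d - t 2)) := by linarith
          exact lt_of_mul_lt_mul_left h6 hp.le
        nlinarith [mul_le_mul_of_nonneg_left hcb.2 h0.le]

lemma intSat_10 (h : Tch r t T) : IntSat T (W r t [1, 0] '' T) := by
  have h0 := h.pos 0; have h1 := h.pos 1; have h2 := h.pos 2; have h3 := h.pos 3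
  have q1 := h.t0; have q2 := h.g01; have q3 := h.tch; have q4 := h.g23; have q5 := h.e1
  obtain ⟨δ, hδ, hI, hS⟩ := h.intSat_C
  have hsub : W r t [1, 0] '' T ⊆ Cm r t T := by
    rintro _ ⟨y, hy, rfl⟩
    exact C_iff.2 (Or.inl ⟨_, h.mem 0 hy, rfl⟩)
  have ml := min_le_left δ (r 1 * (t 1 - r 0))
  have mr := min_le_right δ (r 1 * (t 1 - r 0))
  refine ⟨min δ (r 1 * (t 1 - r 0)), lt_min hδ (mul_pos h1 (by linarith)), ?_,
    hsub.trans hS.1, ?_⟩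
  · intro x hx
    constructor <;> linarith [(hI (hsub hx)).1, (hI (hsub hx)).2]
  · intro x hx y hy hxy
    have hy2 := hS.2 x (hsub hx) y hy (hxy.trans_le ml)
    have hxy2 := abs_lt.1 (hxy.trans_le mr)
    obtain ⟨c, hc, rfl⟩ := hx
    have hcb := h.bd 0 hc
    have hc2 := mul_le_mul_of_nonneg_left hcb.2 h1.le
    simp only [W] at hxy2
    rcases C_iff.1 hy2 with ⟨z, hz, rfl⟩ | ⟨z, hz, rfl⟩
    · obtain ⟨j, z, hz', rfl⟩ := h.cases hz
      have hb := h.bd j hz'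
      by_cases hj : j = 0
      · subst hj
        exact ⟨z, hz', rfl⟩
      · exfalso
        have : t 1 ≤ r j * z + t j := by
          refine le_trans ?_ hb.1
          fin_cases j <;> simp at * <;> linarith
        have := mul_le_mul_of_nonneg_left this h1.le
        nlinarith
    · exfalso
      have := h.bd 2 hz
      have : r 1 * t 1 ≤ r 1 * 1 := mul_le_mul_of_nonneg_left (by linarith) h1.le
      nlinarith

lemma intSat_map (h : Tch r t T) (i) {A : Set ℝ} (hA : IntSat T A) :
    IntSat T ((fun x => r i * x + t i) '' A) := by
  obtain ⟨δ, hδ, hI, hS⟩ := hA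
  have hi := h.pos i
  refine ⟨r i * δ, by positivity, ?_, ?_, ?_⟩
  · rintro _ ⟨x, hx, rfl⟩
    have h1 := hI hx
    have := h.t_nonneg i
    have := h.t_le i
    constructor
    · nlinarith [mul_le_mul_of_nonneg_left h1.1 hi.le]
    · nlinarith [mul_le_mul_of_nonneg_left h1.2 hi.le]
  · rintro _ ⟨x, hx, rfl⟩
    exact h.mem i (hS.1 hx)
  · rintro _ ⟨x, hx, rfl⟩ y hy hxy
    have h1 := hI hx
    have l1 := mul_le_mul_of_nonneg_left h1.1 hi.le
    have l2 := mul_le_mul_of_nonneg_left h1.2 hi.le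
    obtain ⟨j, z, hz, rfl⟩ := h.cases hy
    have hb := h.bd j hz
    by_cases hij : i = j
    · subst hij
      refine ⟨z, hS.2 x hx z hz ?_, rfl⟩
      have e : r i * x + t i - (r i * z + t i) = r i * (x - z) := by ring
      simp only [e, abs_mul, abs_of_pos hi] at hxy
      exact lt_of_mul_lt_mul_left hxy hi.le
    · exfalso
      have hxy := abs_lt.1 hxy
      simp only at hxy
      have h0 := h.pos 0; have h1 := h.pos 1; have h2 := h.pos 2; have h3 := h.pos 3
      have q1 := h.t0; have q2 := h.g01; have q3 := h.tch; have q4 := h.g23; have q5 := h.e1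
      have a1 : r i * δ ≤ r i * x := l1
      have a2 : r i * x + r i * δ ≤ r i := by linarith
      generalize r i * x = X at *
      generalize r j * z = Z at *
      generalize r i * δ = Y at *
      have hor : t i + r i ≤ t j ∨ t j + r j ≤ t i := by
        fin_cases i <;> fin_cases j <;> simp at hij ⊢ <;>
          first
          | (left; linarith)
          | (right; linarith)
      rcases hor with hor | hor <;> linarith [hxy.1, hxy.2, hb.1, hb.2]

lemma intSat_W (h : Tch r t T) (v) {A : Set ℝ} (hA : IntSat T A) : IntSat T (W r t v '' A) := by
  induction v with
  | nil => simpa [W] using hA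
  | cons i v ih =>
    have := h.intSat_map i ih
    rw [image_image] at this
    exact this

end Tch
end FB

namespace FB

variable {r t : Fin 4 → ℝ} {T : Set ℝ}

/-- An affine copy of `T` or of the middle part inside `T`. -/
def Piece (r t : Fin 4 → ℝ) (T : Set ℝ) (a b : ℝ) (E : Set ℝ) : Prop :=
  0 < a ∧ (E = T ∨ E = Cm r t T) ∧ ∀ z ∈ E, a * z + b ∈ T

namespace Tch

lemma stepC (h : Tch r t T) {a b d g : ℝ} (hP : Piece r t T a b (Cm r t T)) {B : Set ℝ}
    (hB : B ⊆ (fun x => a * x + b) '' Cm r t T) (hd : ∀ x ∈ B, ∀ y ∈ B, |x - y| ≤ d)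
    (hg1 : g ≤ r 1 * r 0) (hg2 : g ≤ r 2 * r 0) (hda : d < g * a) :
    ∃ a' b' E', Piece r t T a' b' E' ∧ B ⊆ (fun x => a' * x + b') '' E' ∧
      a' ≤ (r 0 + r 1 + r 2 + r 3) * a := by
  obtain ⟨e, he, hsp⟩ := h.split1
  obtain ⟨ha, -, hT⟩ := hP
  by_cases hall : B ⊆ (fun x => a * x + b) '' Ck r t T 1
  · refine ⟨a * r 0, a * (t 2 - r 0 * t 2) + b, Cm r t T, ⟨mul_pos ha (h.pos 0), Or.inr rfl, ?_⟩,
      ?_, ?_⟩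
    · intro z hz
      have := hT _ (h.hk_mem 1 hz)
      convert this using 1
      simp only [hk]; ring
    · intro x hx
      obtain ⟨_, ⟨y, hy, rfl⟩, rfl⟩ := hall hx
      refine ⟨y, hy, ?_⟩
      simp only [hk]; ring
    · rw [mul_comm]; exact mul_le_mul_of_nonneg_right (h.le_sum 0) ha.le
  · obtain ⟨x, hx, hx2⟩ := Set.not_subset.1 hall
    obtain ⟨c, hc, rfl⟩ := hB hx
    -- sub-claim producing the piece for a letter
    have fin : ∀ i : Fin 4, (∀ z ∈ T, r i * z + t i ∈ Cm r t T) →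
        (∀ c' ∈ Cm r t T, a * c' + b ∈ B → ∃ z ∈ T, c' = r i * z + t i) →
        ∃ a' b' E', Piece r t T a' b' E' ∧ B ⊆ (fun x => a' * x + b') '' E' ∧
          a' ≤ (r 0 + r 1 + r 2 + r 3) * a := by
      intro i hi hi2
      refine ⟨a * r i, a * t i + b, T, ⟨mul_pos ha (h.pos i), Or.inl rfl, ?_⟩, ?_, ?_⟩
      · intro z hz
        have := hT _ (hi z hz)
        convert this using 1; ring
      · intro y hy
        obtain ⟨c', hc', rfl⟩ := hB hy
        obtain ⟨z, hz, rfl⟩ := hi2 c' hc' hy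
        refine ⟨z, hz, ?_⟩
        simp only; ring
      · rw [mul_comm]; exact mul_le_mul_of_nonneg_right (h.le_sum i) ha.le
    rcases hsp c hc with h1 | h1 | h1
    · exact absurd ⟨c, h1, rfl⟩ hx2
    · apply fin 1 (fun z hz => C_iff.2 (Or.inl ⟨z, hz, rfl⟩))
      intro c' hc' hB'
      rcases C_iff.1 hc' with h2 | ⟨z, hz, rfl⟩
      · exact h2
      · exfalso
        have h3 := abs_le.1 (hd _ hx _ hB')
        simp only at h3
        have h4 := h.bd 2 hz
        have h5 : a * (r 1 * r 0 + e) ≤ a * (r 2 * z + t 2 - c) :=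
          mul_le_mul_of_nonneg_left (by linarith) ha.le
        have h6 := mul_le_mul_of_nonneg_right hg1 ha.le
        have h7 := mul_pos ha he
        nlinarith
    · apply fin 2 (fun z hz => C_iff.2 (Or.inr ⟨z, hz, rfl⟩))
      intro c' hc' hB'
      rcases C_iff.1 hc' with ⟨z, hz, rfl⟩ | h2
      · exfalso
        have h3 := abs_le.1 (hd _ hx _ hB')
        simp only at h3
        have h4 := h.bd 1 hz
        have h8 := h.tch
        have h5 : a * (r 2 * r 0 + e) ≤ a * (c - (r 1 * z + t 1)) :=
          mul_le_mul_of_nonneg_left (by linarith) ha.le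
        have h6 := mul_le_mul_of_nonneg_right hg2 ha.le
        have h7 := mul_pos ha he
        nlinarith
      · exact h2

lemma stepT (h : Tch r t T) {a b d g : ℝ} (hP : Piece r t T a b T) {B : Set ℝ}
    (hB : B ⊆ (fun x => a * x + b) '' T) (hd : ∀ x ∈ B, ∀ y ∈ B, |x - y| ≤ d)
    (hg1 : g ≤ r 1 * r 0) (hg2 : g ≤ r 2 * r 0) (hg3 : g ≤ t 1 - r 0)
    (hg4 : g ≤ t 3 - t 2 - r 2) (hda : d < g * a) :
    ∃ a' b' E', Piece r t T a' b' E' ∧ B ⊆ (fun x => a' * x + b') '' E' ∧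
      a' ≤ (r 0 + r 1 + r 2 + r 3) * a := by
  by_cases hall : B ⊆ (fun x => a * x + b) '' Cm r t T
  · exact h.stepC ⟨hP.1, Or.inr rfl, fun z hz => hP.2.2 z (h.C_sub hz)⟩ hall hd hg1 hg2 hda
  obtain ⟨ha, -, hT⟩ := hP
  have h0 := h.pos 0; have h1 := h.pos 1; have h2 := h.pos 2; have h3 := h.pos 3
  have q1 := h.t0; have q2 := h.g01; have q3 := h.tch; have q4 := h.g23; have q5 := h.e1
  obtain ⟨x, hx, hx2⟩ := Set.not_subset.1 hall
  obtain ⟨c, hc, rfl⟩ := hB hx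
  have hcC : c ∉ Cm r t T := fun h' => hx2 ⟨c, h', rfl⟩
  obtain ⟨i, z, hz, rfl⟩ := h.cases hc
  refine ⟨a * r i, a * t i + b, T, ⟨mul_pos ha (h.pos i), Or.inl rfl, ?_⟩, ?_, ?_⟩
  · intro z hz
    have := hT _ (h.mem i hz)
    convert this using 1; ring
  · intro y hy
    obtain ⟨c', hc', rfl⟩ := hB hy
    obtain ⟨j, z', hz', rfl⟩ := h.cases hc'
    have hij : j = i := by
      have bi := h.bd i hz
      have bj := h.bd j hz'
      have h3 := abs_le.1 (hd _ hx _ hy)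
      simp only at h3
      have key1 : ∀ u v : ℝ, g ≤ u - v → a * u + b - (a * v + b) ≤ d → False := by
        intro u v h4 h5
        nlinarith [mul_le_mul_of_nonneg_left h4 ha.le]
      have k1 := fun h4 => key1 (r i * z + t i) (r j * z' + t j) h4 h3.2
      have k2 := fun h4 => key1 (r j * z' + t j) (r i * z + t i) h4 (by linarith)
      have hi1 : i ≠ 1 := by rintro rfl; exact hcC (C_iff.2 (Or.inl ⟨z, hz, rfl⟩))
      have hi2 : i ≠ 2 := by rintro rfl; exact hcC (C_iff.2 (Or.inr ⟨z, hz, rfl⟩))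
      by_contra hne
      generalize r i * z + t i = X at *
      generalize r j * z' + t j = Y at *
      have hi : i = 0 ∨ i = 3 := by
        fin_cases i <;> simp at hi1 hi2 ⊢
      rcases hi with rfl | rfl
      · apply k2
        have : t 1 ≤ t j := by fin_cases j <;> simp at hne ⊢ <;> linarith
        linarith
      · apply k1
        have : t j + r j ≤ t 2 + r 2 := by fin_cases j <;> simp at hne ⊢ <;> linarith
        linarith
    subst hij
    refine ⟨z', hz', ?_⟩
    simp only; ring
  · rw [mul_comm]; exact mul_le_mul_of_nonneg_right (h.le_sum i) ha.le

/-- Zooming: a subset of `T` of diameter `≤ d` lies in a piece of comparable size. -/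
lemma zoom (h : Tch r t T) : ∃ g > 0, ∀ d > 0, ∀ B ⊆ T, (∀ x ∈ B, ∀ y ∈ B, |x - y| ≤ d) →
    ∃ a b E, Piece r t T a b E ∧ B ⊆ (fun x => a * x + b) '' E ∧ g * a ≤ d := by
  have h0 := h.pos 0; have h1 := h.pos 1; have h2 := h.pos 2; have h3 := h.pos 3
  have q1 := h.t0; have q2 := h.g01; have q3 := h.tch; have q4 := h.g23; have q5 := h.e1
  have p1 : 0 < r 1 * r 0 := by positivity
  have p2 : 0 < r 2 * r 0 := by positivity
  have p3 : 0 < t 1 - r 0 := by linarith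
  have p4 : 0 < t 3 - t 2 - r 2 := by linarith
  set g := min (min (r 1 * r 0) (r 2 * r 0)) (min (t 1 - r 0) (t 3 - t 2 - r 2)) with hg
  have g1 : g ≤ r 1 * r 0 := (min_le_left _ _).trans (min_le_left _ _)
  have g2 : g ≤ r 2 * r 0 := (min_le_left _ _).trans (min_le_right _ _)
  have g3 : g ≤ t 1 - r 0 := (min_le_right _ _).trans (min_le_left _ _)
  have g4 : g ≤ t 3 - t 2 - r 2 := (min_le_right _ _).trans (min_le_right _ _)
  have gpos : 0 < g := lt_min (lt_min p1 p2) (lt_min p3 p4)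
  clear_value g
  refine ⟨g, gpos, ?_⟩
  intro d hd B hBT hB
  by_contra hcon
  push Not at hcon
  have hall : ∀ N : ℕ, ∃ a b E, Piece r t T a b E ∧ B ⊆ (fun x => a * x + b) '' E ∧
      a ≤ (r 0 + r 1 + r 2 + r 3) ^ N := by
    intro N
    induction N with
    | zero =>
      refine ⟨1, 0, T, ⟨one_pos, Or.inl rfl, ?_⟩, ?_, by simp⟩
      · intro z hz; simpa using hz
      · intro z hz; exact ⟨z, hBT hz, by simp⟩
    | succ N ih =>
      obtain ⟨a, b, E, hP, hBE, ha⟩ := ih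
      have hda := hcon a b E hP hBE
      have : ∃ a' b' E', Piece r t T a' b' E' ∧ B ⊆ (fun x => a' * x + b') '' E' ∧
          a' ≤ (r 0 + r 1 + r 2 + r 3) * a := by
        rcases hP.2.1 with rfl | rfl
        · exact h.stepT hP hBE hB g1 g2 g3 g4 hda
        · exact h.stepC hP hBE hB g1 g2 hda
      obtain ⟨a', b', E', hP', hB', ha'⟩ := this
      refine ⟨a', b', E', hP', hB', ha'.trans ?_⟩
      rw [pow_succ']
      exact mul_le_mul_of_nonneg_left ha (by positivity)
  obtain ⟨N, hN⟩ := exists_pow_small h.sum_lt (show 0 < d / g by positivity)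
  obtain ⟨a, b, E, hP, hBE, ha⟩ := hall N
  have := hcon a b E hP hBE
  rw [lt_div_iff₀ gpos] at hN
  nlinarith

/-- Finiteness of the ratios of measures of well separated pieces. -/
lemma ratio_finite (h : Tch r t T) {s : ℝ} (hs : 0 ≤ s) {κ : ℝ} (hκ : 0 < κ) :
    ∃ F : Set ℝ, F.Finite ∧ ∀ d > 0, ∀ A A', A' ⊆ A → Sat T A (κ * d) → Sat T A' (κ * d) →
      (∀ x ∈ A, ∀ y ∈ A, |x - y| ≤ d) → (μH[s] A').toReal / (μH[s] A).toReal ∈ F := by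
  obtain ⟨g, hg, hz⟩ := h.zoom
  have hfT : {A | Sat T A (κ * g)}.Finite := sat_finite h.unit (by positivity)
  have hfC : {A | Sat (Cm r t T) A (κ * g)}.Finite :=
    sat_finite (h.C_sub.trans h.unit) (by positivity)
  set 𝒮 := {A | Sat T A (κ * g)} ∪ {A | Sat (Cm r t T) A (κ * g)} with h𝒮
  have hf : 𝒮.Finite := hfT.union hfC
  refine ⟨Set.image2 (fun A' A => (μH[s] A').toReal / (μH[s] A).toReal) 𝒮 𝒮,
    Set.Finite.image2 _ hf hf, ?_⟩
  intro d hd A A' hAA hA hA' hdi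
  obtain ⟨a, b, E, hP, hE, hga⟩ := hz d hd A hA.1 hdi
  have hap := hP.1
  have key : ∀ X : Set ℝ, X ⊆ A → Sat T X (κ * d) → ∃ Y ∈ 𝒮,
      (μH[s] X).toReal = a ^ s * (μH[s] Y).toReal := by
    intro X hXA hX
    have hY : Sat E {z | z ∈ E ∧ a * z + b ∈ X} (κ * g) := by
      refine ⟨fun z hz => hz.1, ?_⟩
      rintro x ⟨hx, hx2⟩ y hy hxy
      refine ⟨hy, hX.2 _ hx2 _ (hP.2.2 y hy) ?_⟩
      have e : a * x + b - (a * y + b) = a * (x - y) := by ring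
      rw [e, abs_mul, abs_of_pos hap]
      calc a * |x - y| < a * (κ * g) := mul_lt_mul_of_pos_left hxy hap
        _ = κ * (g * a) := by ring
        _ ≤ κ * d := mul_le_mul_of_nonneg_left hga hκ.le
    refine ⟨{z | z ∈ E ∧ a * z + b ∈ X}, ?_, ?_⟩
    · rcases hP.2.1 with rfl | rfl
      · exact Or.inl hY
      · exact Or.inr hY
    · have himg : X = (fun x => a * x + b) '' {z | z ∈ E ∧ a * z + b ∈ X} := by
        ext x
        constructor
        · intro hx
          obtain ⟨z, hz, rfl⟩ := hE (hXA hx)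
          exact ⟨z, ⟨hz, hx⟩, rfl⟩
        · rintro ⟨z, hz, rfl⟩; exact hz.2
      conv_lhs => rw [himg]
      rw [haus_affine hs hap, ENNReal.toReal_mul, ENNReal.toReal_ofReal (by positivity)]
  obtain ⟨Y, hY, e1⟩ := key A Subset.rfl hA
  obtain ⟨Y', hY', e2⟩ := key A' hAA hA'
  refine ⟨Y', hY', Y, hY, ?_⟩
  rw [e1, e2, mul_div_mul_left _ _ (by positivity)]

end Tch

/-- The maximality argument giving a cylinder on which the density is constant. -/
lemma const_density (q : List (Fin 4) → ℝ) (m : Fin 4 → ℝ) (hm : ∀ i, 0 < m i)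
    (hsum : ∑ i, m i = 1) (hq : ∀ w, 0 < q w) {K : ℝ} (hK : ∀ w, q w ≤ K)
    (hadd : ∀ w, q w = ∑ i, m i * q (w ++ [i])) {F : Set ℝ} (hF : F.Finite)
    (hqF : ∀ w i, q (w ++ [i]) / q w ∈ F) : ∃ w, ∀ u, q (w ++ u) = q w := by
  -- gap above one
  obtain ⟨δ, hδ, hgap⟩ : ∃ δ > 0, ∀ a ∈ F, 1 < a → 1 + δ ≤ a := by
    have hf : ({a ∈ F | 1 < a}).Finite := hF.subset (fun a ha => ha.1)
    rcases ({a ∈ F | 1 < a}).eq_empty_or_nonempty with he | hne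
    · refine ⟨1, one_pos, fun a ha h1 => ?_⟩
      have : a ∈ ({a ∈ F | 1 < a} : Set ℝ) := ⟨ha, h1⟩
      rw [he] at this; exact this.elim
    · obtain ⟨b, hb, hmin⟩ := Set.exists_min_image _ id hf hne
      refine ⟨b - 1, by linarith [hb.2], fun a ha h1 => ?_⟩
      have := hmin a ⟨ha, h1⟩
      simp only [id] at this; linarith
  set R := sSup (Set.range q)
  have hbdd : BddAbove (Set.range q) := ⟨K, by rintro _ ⟨w, rfl⟩; exact hK w⟩
  have hR : ∀ w, q w ≤ R := fun w => le_csSup hbdd ⟨w, rfl⟩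
  have hRpos : 0 < R := (hq []).trans_le (hR [])
  have : R / (1 + δ) < R := by
    rw [div_lt_iff₀ (by linarith)]; nlinarith
  obtain ⟨_, ⟨w, rfl⟩, hw⟩ := exists_lt_of_lt_csSup (Set.range_nonempty q) this
  rw [div_lt_iff₀ (by linarith)] at hw
  have step : ∀ v, R < q v * (1 + δ) → ∀ i, q (v ++ [i]) = q v := by
    intro v hv
    have hle : ∀ i, q (v ++ [i]) ≤ q v := by
      intro i
      by_contra hcon
      push Not at hcon
      have h1 : 1 < q (v ++ [i]) / q v := by rwa [lt_div_iff₀ (hq v), one_mul]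
      have h2 := hgap _ (hqF v i) h1
      rw [le_div_iff₀ (hq v)] at h2
      have := hR (v ++ [i])
      linarith
    have hs : ∑ i, m i * (q v - q (v ++ [i])) = 0 := by
      simp only [mul_sub, Finset.sum_sub_distrib, ← Finset.sum_mul, hsum, ← hadd]
      ring
    intro i
    have := (Finset.sum_eq_zero_iff_of_nonneg (fun i _ =>
      mul_nonneg (hm i).le (sub_nonneg.2 (hle i)))).1 hs i (Finset.mem_univ i)
    rcases mul_eq_zero.1 this with h3 | h3
    · exact absurd h3 (hm i).ne'
    · linarith
  refine ⟨w, fun u => ?_⟩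
  induction u using List.reverseRecOn with
  | nil => simp
  | append_singleton u i ih =>
    rw [← List.append_assoc, step (w ++ u) (by rw [ih]; exact hw), ih]

end FB

namespace FB

/-- All the data of a bi-Lipschitz equivalence between the dust and the touching set. -/
structure Eqv (r t d : Fin 4 → ℝ) (T D : Set ℝ) (g s c c' : ℝ) (f : ℝ → ℝ) : Prop where
  tc : Tch r t T
  comp : IsCompact D
  ne : D.Nonempty
  inv : D = ⋃ i, (fun x => r i * x + d i) '' D
  gpos : 0 < g
  sep : Sep r d D g
  unit : D ⊆ Icc 0 1
  spos : 0 < s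
  sum : ∑ i, r i ^ s = 1
  cpos : 0 < c
  cle : c ≤ c'
  bij : BijOn f D T
  lo : ∀ x ∈ D, ∀ y ∈ D, c * |x - y| ≤ |f x - f y|
  hi : ∀ x ∈ D, ∀ y ∈ D, |f x - f y| ≤ c' * |x - y|

variable {r t d : Fin 4 → ℝ} {T D : Set ℝ} {g s c c' : ℝ} {f : ℝ → ℝ}

namespace Eqv

lemma c'pos (h : Eqv r t d T D g s c c' f) : 0 < c' := h.cpos.trans_le h.cle

lemma lipOn (h : Eqv r t d T D g s c c' f) : LipschitzOnWith c'.toNNReal f D := by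
  apply LipschitzOnWith.of_dist_le_mul
  intro x hx y hy
  rw [Real.coe_toNNReal _ h.c'pos.le]
  exact h.hi x hx y hy

lemma haus_hi (h : Eqv r t d T D g s c c' f) {A : Set ℝ} (hA : A ⊆ D) :
    μH[s] (f '' A) ≤ ENNReal.ofReal (c' ^ s) * μH[s] A := by
  have := (h.lipOn.mono hA).hausdorffMeasure_image_le h.spos.le
  rwa [← ENNReal.ofReal, ENNReal.ofReal_rpow_of_pos h.c'pos] at this

lemma haus_lo (h : Eqv r t d T D g s c c' f) {A : Set ℝ} (hA : A ⊆ D) :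
    μH[s] A ≤ ENNReal.ofReal (c⁻¹ ^ s) * μH[s] (f '' A) := by
  have hci : 0 < c⁻¹ := inv_pos.2 h.cpos
  have hinj := h.bij.injOn
  have hl : LipschitzOnWith (c⁻¹).toNNReal (Function.invFunOn f D) (f '' A) := by
    apply LipschitzOnWith.of_dist_le_mul
    rintro _ ⟨x, hx, rfl⟩ _ ⟨y, hy, rfl⟩
    rw [hinj.leftInvOn_invFunOn (hA hx), hinj.leftInvOn_invFunOn (hA hy),
      Real.coe_toNNReal _ hci.le, Real.dist_eq, Real.dist_eq]
    have := h.lo x (hA hx) y (hA hy)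
    rw [inv_mul_eq_div, le_div_iff₀ h.cpos]; linarith
  have := hl.hausdorffMeasure_image_le h.spos.le
  rw [← ENNReal.ofReal, ENNReal.ofReal_rpow_of_pos hci] at this
  have e : Function.invFunOn f D '' (f '' A) = A := by
    rw [image_image]
    ext x
    constructor
    · rintro ⟨z, hz, rfl⟩
      simpa only [hinj.leftInvOn_invFunOn (hA hz)] using hz
    · intro hx; exact ⟨x, hx, hinj.leftInvOn_invFunOn (hA hx)⟩
  rwa [e] at this

lemma HD_ne_top (h : Eqv r t d T D g s c c' f) : μH[s] D ≠ ⊤ :=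
  ne_top_of_le_ne_top ENNReal.one_ne_top
    (haus_finite h.inv h.unit h.tc.pos h.tc.le_sum h.tc.sum_lt h.spos h.sum)

lemma HD_ne_zero (h : Eqv r t d T D g s c c' f) : μH[s] D ≠ 0 :=
  haus_pos h.inv h.comp h.ne h.gpos h.sep h.tc.pos h.tc.le_sum h.tc.sum_lt h.spos h.sum

lemma HT_ne_top (h : Eqv r t d T D g s c c' f) : μH[s] T ≠ ⊤ := by
  have := h.haus_hi Subset.rfl
  rw [h.bij.image_eq] at this
  exact ne_top_of_le_ne_top (ENNReal.mul_ne_top ENNReal.ofReal_ne_top h.HD_ne_top) this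

lemma HT_ne_zero (h : Eqv r t d T D g s c c' f) : μH[s] T ≠ 0 := by
  have := h.haus_lo Subset.rfl
  rw [h.bij.image_eq] at this
  intro h0
  rw [h0, mul_zero] at this
  exact h.HD_ne_zero (le_antisymm this bot_le)

lemma HT_pos (h : Eqv r t d T D g s c c' f) : 0 < (μH[s] T).toReal :=
  ENNReal.toReal_pos h.HT_ne_zero h.HT_ne_top

lemma H_sub_ne_top (h : Eqv r t d T D g s c c' f) {A : Set ℝ} (hA : A ⊆ T) : μH[s] A ≠ ⊤ :=
  ne_top_of_le_ne_top h.HT_ne_top (measure_mono hA)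

/-- Image of a dust cylinder. -/
lemma FD_sub (h : Eqv r t d T D g s c c' f) (w) : f '' (W r d w '' D) ⊆ T := by
  rw [← h.bij.image_eq]; exact image_mono (cyl_sub h.inv w)

lemma FD_pos (h : Eqv r t d T D g s c c' f) (w) : 0 < (μH[s] (f '' (W r d w '' D))).toReal := by
  refine ENNReal.toReal_pos ?_ (h.H_sub_ne_top (h.FD_sub w))
  intro h0
  have := h.haus_lo (cyl_sub h.inv w)
  rw [h0, mul_zero, haus_W h.spos.le h.tc.pos] at this
  have h1 := le_antisymm this bot_le
  rcases mul_eq_zero.1 h1 with h2 | h2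
  · rw [ENNReal.ofReal_eq_zero] at h2
    have := Real.rpow_pos_of_pos (sc_pos h.tc.pos w) s
    linarith
  · exact h.HD_ne_zero h2

lemma FD_le (h : Eqv r t d T D g s c c' f) (w) : (μH[s] (f '' (W r d w '' D))).toReal ≤
    c' ^ s * (μH[s] D).toReal * sc (fun i => r i ^ s) w := by
  have h1 := h.haus_hi (cyl_sub h.inv w)
  rw [haus_W h.spos.le h.tc.pos] at h1
  have h2 := ENNReal.toReal_mono (ENNReal.mul_ne_top ENNReal.ofReal_ne_top
    (ENNReal.mul_ne_top ENNReal.ofReal_ne_top h.HD_ne_top)) h1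
  have h3 := Real.rpow_pos_of_pos h.c'pos s
  have h4 := Real.rpow_pos_of_pos (sc_pos h.tc.pos w) s
  rw [ENNReal.toReal_mul, ENNReal.toReal_mul, ENNReal.toReal_ofReal h3.le,
    ENNReal.toReal_ofReal h4.le] at h2
  rw [sc_rpow h.tc.pos]
  linarith

lemma FD_sat (h : Eqv r t d T D g s c c' f) (w) :
    Sat T (f '' (W r d w '' D)) (c * (g * sc r w)) := by
  refine ⟨h.FD_sub w, ?_⟩
  rintro _ ⟨x, hx, rfl⟩ y hy hxy
  obtain ⟨y, hyD, rfl⟩ := h.bij.surjOn hy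
  refine ⟨y, (sat_cyl h.inv h.gpos h.sep h.tc.pos h.tc.lt_one w).2 x hx y hyD ?_, rfl⟩
  have := h.lo x (cyl_sub h.inv w hx) y hyD
  exact lt_of_mul_lt_mul_left (this.trans_lt hxy) h.cpos.le

lemma FD_diam (h : Eqv r t d T D g s c c' f) (w) :
    ∀ x ∈ f '' (W r d w '' D), ∀ y ∈ f '' (W r d w '' D), |x - y| ≤ c' * sc r w := by
  rintro _ ⟨_, ⟨x, hx, rfl⟩, rfl⟩ _ ⟨_, ⟨y, hy, rfl⟩, rfl⟩
  refine (h.hi _ (cyl_sub h.inv w ⟨x, hx, rfl⟩) _ (cyl_sub h.inv w ⟨y, hy, rfl⟩)).trans ?_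
  refine mul_le_mul_of_nonneg_left ?_ h.c'pos.le
  rw [W_abs h.tc.pos]
  have : |x - y| ≤ 1 := by
    have h1 := h.unit hx; have h2 := h.unit hy
    rw [abs_le]; constructor <;> linarith [h1.1, h1.2, h2.1, h2.2]
  nlinarith [sc_pos h.tc.pos w]

lemma FD_meas (h : Eqv r t d T D g s c c' f) (w) : MeasurableSet (f '' (W r d w '' D)) := by
  have h1 : IsCompact (W r d w '' D) := h.comp.image (W_cont w)
  exact (h1.image_of_continuousOn (h.lipOn.continuousOn.mono (cyl_sub h.inv w))).measurableSet

lemma haus_union (h : Eqv r t d T D g s c c' f) (w) (N) (U : Finset (List (Fin 4)))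
    (hU : U ⊆ wds N) : (μH[s] (⋃ u ∈ U, f '' (W r d (w ++ u) '' D))).toReal =
      ∑ u ∈ U, (μH[s] (f '' (W r d (w ++ u) '' D))).toReal := by
  rw [measure_biUnion_finset, ENNReal.toReal_sum]
  · intro u _; exact h.H_sub_ne_top (h.FD_sub _)
  · intro u hu v hv huv
    have h1 := cyl_disj' h.inv h.gpos h.sep h.tc.pos w u v
      ((mem_wds.1 (hU hu)).trans (mem_wds.1 (hU hv)).symm) huv
    rw [Function.onFun, Set.disjoint_left]
    rintro _ ⟨x, hx, rfl⟩ ⟨y, hy, hxy⟩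
    have := h.bij.injOn (cyl_sub h.inv _ hy) (cyl_sub h.inv _ hx) hxy
    subst this
    exact Set.disjoint_left.1 h1 hx hy
  · intro u _; exact h.FD_meas _

lemma FD_split (h : Eqv r t d T D g s c c' f) (w) :
    (μH[s] (f '' (W r d w '' D))).toReal =
      ∑ i, (μH[s] (f '' (W r d (w ++ [i]) '' D))).toReal := by
  have e : f '' (W r d w '' D) = ⋃ u ∈ wds 1, f '' (W r d (w ++ u) '' D) := by
    ext x
    simp only [mem_iUnion]
    constructor
    · rintro ⟨y, hy, rfl⟩
      obtain ⟨u, hu, hyu⟩ := cyl_exists' h.inv 1 w y hy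
      exact ⟨u, mem_wds.2 hu, y, hyu, rfl⟩
    · rintro ⟨u, _, y, hy, rfl⟩
      exact ⟨y, cyl_append_sub h.inv w u hy, rfl⟩
  rw [e, h.haus_union w 1 _ Subset.rfl]
  have e2 : wds 1 = Finset.univ.image (fun i : Fin 4 => [i]) := by
    ext u
    rw [mem_wds, List.length_eq_one_iff]
    simp [eq_comm]
  rw [e2, Finset.sum_image]
  intro i _ j _ hij
  simpa using hij

/-- Constant density on a cylinder. -/
lemma const (h : Eqv r t d T D g s c c' f) : ∃ w0 : List (Fin 4), ∃ l > 0, ∀ u,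
    (μH[s] (f '' (W r d (w0 ++ u) '' D))).toReal = l * sc (fun i => r i ^ s) (w0 ++ u) := by
  set m : Fin 4 → ℝ := fun i => r i ^ s with hmdef
  have hm : ∀ i, 0 < m i := fun i => Real.rpow_pos_of_pos (h.tc.pos i) s
  have hc := h.cpos; have hc' := h.c'pos; have hg := h.gpos
  obtain ⟨i0, hi0⟩ := Finite.exists_min r
  have hr0 := h.tc.pos i0
  set κ := c * g * r i0 / c' with hκdef
  have hκ : 0 < κ := by positivity
  obtain ⟨F, hF, hFr⟩ := h.tc.ratio_finite h.spos.le hκ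
  set q : List (Fin 4) → ℝ := fun w => (μH[s] (f '' (W r d w '' D))).toReal / sc m w with hq
  have hqpos : ∀ w, 0 < q w := fun w => div_pos (h.FD_pos w) (sc_pos hm w)
  obtain ⟨w0, hw0⟩ := const_density q m hm h.sum hqpos (K := c' ^ s * (μH[s] D).toReal)
    (fun w => by rw [hq]; simp only; rw [div_le_iff₀ (sc_pos hm w)]; exact h.FD_le w)
    (fun w => by
      simp only [hq, sc_append, sc_singleton]
      rw [h.FD_split w, Finset.sum_div]
      refine Finset.sum_congr rfl fun i _ => ?_
      have := (hm i).ne'; have := (sc_pos hm w).ne'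
      field_simp)
    (F := ⋃ i, (fun x => x / m i) '' F) (finite_iUnion fun i => hF.image _)
    (fun w i => by
      refine mem_iUnion.2 ⟨i, _, hFr (c' * sc r w) (mul_pos hc' (sc_pos h.tc.pos w))
        (f '' (W r d w '' D)) (f '' (W r d (w ++ [i]) '' D))
        (image_mono (cyl_append_sub h.inv w [i])) ?_ ?_ (h.FD_diam w), ?_⟩
      · have h1 := h.FD_sat w
        refine ⟨h1.1, fun x hx y hy hxy => h1.2 x hx y hy (hxy.trans_le ?_)⟩
        have : κ * (c' * sc r w) = r i0 * (c * (g * sc r w)) := by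
          rw [hκdef]; field_simp
        rw [this]
        have h2 : 0 < c * (g * sc r w) := by have := sc_pos h.tc.pos w; positivity
        nlinarith [h.tc.lt_one i0]
      · have h1 := h.FD_sat (w ++ [i])
        refine ⟨h1.1, fun x hx y hy hxy => h1.2 x hx y hy (hxy.trans_le ?_)⟩
        have : κ * (c' * sc r w) = r i0 * (c * (g * sc r w)) := by
          rw [hκdef]; field_simp
        rw [this, sc_append, sc_singleton]
        have h2 : 0 < c * (g * sc r w) := by have := sc_pos h.tc.pos w; positivity
        nlinarith [hi0 i]
      · simp only [hq, sc_append, sc_singleton]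
        have := (hm i).ne'; have := (sc_pos hm w).ne'; have := (h.FD_pos w).ne'
        field_simp)
  refine ⟨w0, q w0, hqpos w0, fun u => ?_⟩
  rw [← hw0 u]
  simp only [hq]
  rw [div_mul_cancel₀ _ (sc_pos hm _).ne']

/-- Measure of a saturated piece inside a cylinder of constant density. -/
lemma piece (h : Eqv r t d T D g s c c' f) {w0 : List (Fin 4)} {l : ℝ}
    (hl : ∀ u, (μH[s] (f '' (W r d (w0 ++ u) '' D))).toReal =
      l * sc (fun i => r i ^ s) (w0 ++ u)) (w1 : List (Fin 4)) {P : Set ℝ} {δ : ℝ} (hδ : 0 < δ)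
    (hP : Sat T P δ) (hsub : P ⊆ f '' (W r d (w0 ++ w1) '' D)) :
    ∃ (N : ℕ) (U : Finset (List (Fin 4))),
      (∀ u : List (Fin 4), u.length = N → ∀ x ∈ W r d (w0 ++ w1 ++ u) '' D, f x ∈ P → u ∈ U) ∧
      (μH[s] P).toReal = l * sc (fun i => r i ^ s) (w0 ++ w1) *
        ∑ u ∈ U, sc (fun i => r i ^ s) u := by
  classical
  have hc' := h.c'pos
  obtain ⟨N, hN⟩ := exists_pow_small h.tc.sum_lt (div_pos hδ hc')
  set w := w0 ++ w1 with hw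
  set U := (wds N).filter (fun u => f '' (W r d (w ++ u) '' D) ⊆ P) with hU
  have hmem : ∀ u : List (Fin 4), u.length = N → ∀ x ∈ W r d (w ++ u) '' D, f x ∈ P → u ∈ U := by
    intro u hu x hx hfx
    rw [hU, Finset.mem_filter, mem_wds]
    refine ⟨hu, ?_⟩
    intro z hz
    refine hP.2 _ hfx _ (h.FD_sub _ hz) ?_
    refine (h.FD_diam (w ++ u) _ ⟨x, hx, rfl⟩ z hz).trans_lt ?_
    rw [lt_div_iff₀ hc'] at hN
    have h1 : sc r (w ++ u) ≤ sc r u := by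
      rw [sc_append]
      have h2 : sc r w ≤ 1 := by simpa using sc_le_pow h.tc.pos (fun i => (h.tc.lt_one i).le) w
      nlinarith [sc_pos h.tc.pos u]
    have h3 := sc_le_pow h.tc.pos h.tc.le_sum u
    rw [hu] at h3
    nlinarith
  refine ⟨N, U, hmem, ?_⟩
  have e : P = ⋃ u ∈ U, f '' (W r d (w ++ u) '' D) := by
    apply Subset.antisymm
    · intro x hx
      obtain ⟨y, hy, rfl⟩ := hsub hx
      obtain ⟨u, hu, hyu⟩ := cyl_exists' h.inv N w y hy
      exact mem_iUnion₂.2 ⟨u, hmem u hu y hyu hx, y, hyu, rfl⟩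
    · refine iUnion₂_subset fun u hu => ?_
      rw [hU, Finset.mem_filter] at hu
      exact hu.2
  conv_lhs => rw [e]
  rw [h.haus_union w N U (Finset.filter_subset _ _), Finset.mul_sum]
  refine Finset.sum_congr rfl fun u _ => ?_
  rw [hw, List.append_assoc, hl, ← List.append_assoc, sc_append (u := w0 ++ w1) (v := u)]
  ring

lemma haus_Cm (h : Eqv r t d T D g s c c' f) : (μH[s] (Cm r t T)).toReal =
    (r 1 ^ s + r 2 ^ s) * (μH[s] T).toReal := by
  have hnull : μH[s] (W r t [1] '' T ∩ W r t [2] '' T) = 0 := by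
    have := Measure.nullSingletonClass_hausdorff ℝ h.spos
    refine measure_mono_null ?_ (measure_singleton (t 2))
    rintro x ⟨⟨y, hy, rfl⟩, ⟨z, hz, hzx⟩⟩
    simp only [W] at hzx ⊢
    have h1 := h.tc.bd 1 hy
    have h2 := h.tc.bd 2 hz
    have := h.tc.tch
    rw [mem_singleton_iff]
    linarith [h1.2, h2.1]
  have hmeas : MeasurableSet (W r t [2] '' T) := (h.tc.comp.image (W_cont _)).measurableSet
  have h1 := measure_union_add_inter (μ := μH[s]) (W r t [1] '' T) hmeas
  rw [hnull, add_zero, haus_W h.spos.le h.tc.pos, haus_W h.spos.le h.tc.pos, sc_singleton,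
    sc_singleton] at h1
  have p1 := Real.rpow_pos_of_pos (h.tc.pos 1) s
  have p2 := Real.rpow_pos_of_pos (h.tc.pos 2) s
  rw [Cm, h1, ENNReal.toReal_add, ENNReal.toReal_mul, ENNReal.toReal_mul,
    ENNReal.toReal_ofReal p1.le, ENNReal.toReal_ofReal p2.le]
  · ring
  · exact ENNReal.mul_ne_top ENNReal.ofReal_ne_top h.HT_ne_top
  · exact ENNReal.mul_ne_top ENNReal.ofReal_ne_top h.HT_ne_top

lemma haus_Ck (h : Eqv r t d T D g s c c' f) (v k) : (μH[s] (W r t v '' Ck r t T k)).toReal =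
    sc (fun i => r i ^ s) v * ((r 0 ^ s) ^ k * ((r 1 ^ s + r 2 ^ s) * (μH[s] T).toReal)) := by
  have hp := h.tc.pos 0
  have e : hk r t k = fun y => r 0 ^ k * y + (t 2 - r 0 ^ k * t 2) := by
    funext y; simp only [hk]; ring
  have p0 : 0 < r 0 ^ k := by positivity
  have p1 := Real.rpow_pos_of_pos p0 s
  have p2 := Real.rpow_pos_of_pos (sc_pos h.tc.pos v) s
  rw [haus_W h.spos.le h.tc.pos, Ck, e, haus_affine h.spos.le p0, ENNReal.toReal_mul,
    ENNReal.toReal_mul, h.haus_Cm, ENNReal.toReal_ofReal p1.le, ENNReal.toReal_ofReal p2.le,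
    sc_rpow h.tc.pos]
  congr 2
  rw [← Real.rpow_natCast, ← Real.rpow_natCast, ← Real.rpow_mul hp.le, ← Real.rpow_mul hp.le,
    mul_comm]

lemma haus_10 (h : Eqv r t d T D g s c c' f) (v) :
    (μH[s] (W r t v '' (W r t [1, 0] '' T))).toReal =
    sc (fun i => r i ^ s) v * (r 1 ^ s * r 0 ^ s * (μH[s] T).toReal) := by
  have p1 := Real.rpow_pos_of_pos (sc_pos h.tc.pos [1, 0]) s
  have p2 := Real.rpow_pos_of_pos (sc_pos h.tc.pos v) s
  rw [haus_W h.spos.le h.tc.pos, haus_W h.spos.le h.tc.pos, ENNReal.toReal_mul,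
    ENNReal.toReal_mul, ENNReal.toReal_ofReal p1.le, ENNReal.toReal_ofReal p2.le,
    ← sc_rpow h.tc.pos, ← sc_rpow h.tc.pos, sc_cons, sc_singleton]

/-- The arithmetic consequence of Lipschitz equivalence. -/
theorem identity (h : Eqv r t d T D g s c c' f) {m : Fin 4 → ℝ} (hm : m = fun i => r i ^ s) :
    ∃ (w0 : List (Fin 4)) (y : ℝ) (U' : Finset (List (Fin 4))), y ∈ W r d w0 '' D ∧
      0 < ∑ u ∈ U', sc m u ∧
      ∀ w1, y ∈ W r d (w0 ++ w1) '' D → ∃ (k N : ℕ) (U : Finset (List (Fin 4))),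
        (∀ u : List (Fin 4), u.length = N → y ∈ W r d (w0 ++ w1 ++ u) '' D → u ∈ U) ∧
        (m 1 + m 2) * m 0 ^ k * (sc m w0 * ∑ u ∈ U', sc m u) =
          m 1 * m 0 * (sc m (w0 ++ w1) * ∑ u ∈ U, sc m u) := by
  obtain ⟨w0, l, hl0, hl⟩ := h.const
  have hmp : ∀ i, 0 < m i := fun i => by rw [hm]; exact Real.rpow_pos_of_pos (h.tc.pos i) s
  -- a touching cylinder inside
  obtain ⟨v, hv⟩ : ∃ v, W r t v '' T ⊆ f '' (W r d w0 '' D) := by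
    obtain ⟨x, hx⟩ := h.ne
    have hz : f (W r d w0 x) ∈ f '' (W r d w0 '' D) := ⟨_, ⟨x, hx, rfl⟩, rfl⟩
    have hS := h.FD_sat w0
    have hpos : 0 < c * (g * sc r w0) :=
      mul_pos h.cpos (mul_pos h.gpos (sc_pos h.tc.pos w0))
    obtain ⟨N, hN⟩ := exists_pow_small h.tc.sum_lt hpos
    obtain ⟨v, hvN, a, ha, hav⟩ := cyl_exists h.tc.inv N _ (h.FD_sub _ hz)
    refine ⟨v, ?_⟩
    rintro _ ⟨b, hb, rfl⟩
    refine hS.2 _ hz _ (cyl_sub h.tc.inv v ⟨b, hb, rfl⟩) ?_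
    rw [← hav, W_abs h.tc.pos]
    have h1 := sc_le_pow h.tc.pos h.tc.le_sum v
    rw [hvN] at h1
    have : |a - b| ≤ 1 := by
      have h1 := h.tc.unit ha; have h2 := h.tc.unit hb
      rw [abs_le]; constructor <;> linarith [h1.1, h1.2, h2.1, h2.2]
    nlinarith [sc_pos h.tc.pos v]
  have htT : t 2 ∈ T := h.tc.C_sub (h.tc.Ck_sub_C 0 (h.tc.tp_mem 0))
  obtain ⟨y, hy, hfy⟩ := hv ⟨t 2, htT, rfl⟩
  have hHT := h.HT_pos
  -- the reference piece
  obtain ⟨δ, hδ, -, hS⟩ := h.tc.intSat_W v h.tc.intSat_10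
  obtain ⟨N', U', -, hU'⟩ := h.piece hl [] hδ hS (by
    rw [List.append_nil]
    exact (image_mono (cyl_sub h.tc.inv _)).trans hv)
  rw [h.haus_10, List.append_nil, ← hm] at hU'
  have hm' : ∀ i, r i ^ s = m i := fun i => by rw [hm]
  simp only [hm'] at hU'
  have hUpos : 0 < ∑ u ∈ U', sc m u := by
    have h1 : 0 < sc m v * (m 1 * m 0 * (μH[s] T).toReal) :=
      mul_pos (sc_pos hmp v) (mul_pos (mul_pos (hmp 1) (hmp 0)) hHT)
    rw [hU'] at h1
    exact pos_of_mul_pos_right h1 (mul_pos hl0 (sc_pos hmp w0)).le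
  refine ⟨w0, y, U', hy, hUpos, ?_⟩
  intro w1 hyw
  have hpos : 0 < c * (g * sc r (w0 ++ w1)) :=
    mul_pos h.cpos (mul_pos h.gpos (sc_pos h.tc.pos _))
  obtain ⟨k, hk0⟩ := exists_pow_small (h.tc.lt_one 0) hpos
  obtain ⟨δ, hδ, -, hS⟩ := h.tc.intSat_W v (h.tc.intSat_Ck k)
  obtain ⟨N, U, hUm, hU⟩ := h.piece hl w1 hδ hS (by
    rintro _ ⟨_, ⟨z, hz, rfl⟩, rfl⟩
    refine (h.FD_sat (w0 ++ w1)).2 _ ⟨y, hyw, rfl⟩ _ ?_ ?_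
    · exact cyl_sub h.tc.inv v ⟨_, h.tc.C_sub (h.tc.hk_mem k hz), rfl⟩
    · rw [hfy, W_abs h.tc.pos]
      have hzT := h.tc.unit (h.tc.C_sub hz)
      have htu := h.tc.unit htT
      have h1 : sc r v ≤ 1 := by simpa using sc_le_pow h.tc.pos (fun i => (h.tc.lt_one i).le) v
      have e : t 2 - hk r t k z = r 0 ^ k * (t 2 - z) := by simp only [hk]; ring
      have p0 : 0 < r 0 ^ k := pow_pos (h.tc.pos 0) k
      rw [e, abs_mul, abs_of_pos p0]
      have h2 : |t 2 - z| ≤ 1 := by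
        rw [abs_le]; constructor <;> linarith [hzT.1, hzT.2, htu.1, htu.2]
      have h3 : r 0 ^ k * |t 2 - z| ≤ r 0 ^ k := by nlinarith
      have h4 : 0 ≤ r 0 ^ k * |t 2 - z| := by positivity
      nlinarith [sc_pos h.tc.pos v])
  rw [h.haus_Ck, ← hm] at hU
  simp only [hm'] at hU
  refine ⟨k, N, U, fun u hu hyu => hUm u hu y hyu ?_, ?_⟩
  · rw [hfy]; exact ⟨_, h.tc.tp_mem k, rfl⟩
  · have hne : l * sc m v * (μH[s] T).toReal ≠ 0 :=
      (mul_pos (mul_pos hl0 (sc_pos hmp v)) hHT).ne'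
    apply mul_left_cancel₀ hne
    linear_combination (-(sc m v * (m 1 + m 2) * m 0 ^ k * (μH[s] T).toReal)) * hU' +
      (sc m v * m 1 * m 0 * (μH[s] T).toReal) * hU

end Eqv
end FB

namespace FB

lemma sc_hom {A B : Type*} [CommRing A] [CommRing B] (φ : A →+* B) (M : Fin 4 → A)
    (w : List (Fin 4)) : φ (sc M w) = sc (fun i => φ (M i)) w := by
  induction w with
  | nil => simp [sc_nil]
  | cons i w ih => simp [sc_cons, ih]

lemma sc_pow_dvd {A : Type*} [CommRing A] (M : Fin 4 → A) (i : Fin 4)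
    (w : List (Fin 4)) : M i ^ w.count i ∣ sc M w := by
  induction w with
  | nil => simp [sc_nil]
  | cons j w ih =>
    rw [sc_cons, List.count_cons]
    by_cases hij : j = i
    · subst hij
      simp only [BEq.rfl, if_true, pow_succ]
      rw [mul_comm]
      exact mul_dvd_mul_left _ ih
    · simp only [beq_iff_eq, hij, if_false, add_zero]
      exact ih.mul_left _

lemma sc_ne_zero {A : Type*} [CommRing A] [IsDomain A] (M : Fin 4 → A) (hM : ∀ i, M i ≠ 0)
    (w : List (Fin 4)) : sc M w ≠ 0 := by
  induction w with
  | nil => simp [sc_nil]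
  | cons j w ih => rw [sc_cons]; exact mul_ne_zero (hM j) ih

/-- The polynomial versions of the weights. -/
def PM : Fin 4 → MvPolynomial (Fin 2) ℚ :=
  ![MvPolynomial.C (1/2) * (1 - MvPolynomial.X 0 - MvPolynomial.X 1), MvPolynomial.X 0,
    MvPolynomial.X 1, MvPolynomial.C (1/2) * (1 - MvPolynomial.X 0 - MvPolynomial.X 1)]

lemma X_pow_dvd_le {Q : MvPolynomial (Fin 2) ℚ} (hQ : Q ≠ 0) (j : Fin 2) (n : ℕ)
    (h : (MvPolynomial.X j) ^ n ∣ Q) : n ≤ Q.totalDegree := by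
  obtain ⟨c, rfl⟩ := h
  have hc : c ≠ 0 := by rintro rfl; simp at hQ
  rw [MvPolynomial.totalDegree_mul_of_isDomain (pow_ne_zero _ (MvPolynomial.X_ne_zero _)) hc,
    MvPolynomial.totalDegree_X_pow]
  omega

lemma not_dvd (j : Fin 2) (k : ℕ) : ¬ (MvPolynomial.X j : MvPolynomial (Fin 2) ℚ) ∣
    (PM 1 + PM 2) * PM 0 ^ k := by
  rintro ⟨c, hc⟩
  have h := congrArg (MvPolynomial.eval (fun i : Fin 2 => if i = j then (0:ℚ) else 1/2)) hc
  fin_cases j <;> simp [PM] at h <;> norm_num at h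

theorem alg (m : Fin 4 → ℝ) (hm : ∀ i, 0 < m i) (h03 : m 0 = m 3) (hsum : ∑ i, m i = 1)
    (Y : List (Fin 4) → Prop) (hY0 : Y [])
    (hYe : ∀ w N, Y w → ∃ u : List (Fin 4), u.length = N ∧ Y (w ++ u))
    (w0 : List (Fin 4)) (U' : Finset (List (Fin 4))) (hU' : 0 < ∑ u ∈ U', sc m u)
    (hid : ∀ w1, Y w1 → ∃ (k N : ℕ) (U : Finset (List (Fin 4))),
        (∀ u : List (Fin 4), u.length = N → Y (w1 ++ u) → u ∈ U) ∧
        (m 1 + m 2) * m 0 ^ k * (sc m w0 * ∑ u ∈ U', sc m u) =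
          m 1 * m 0 * (sc m (w0 ++ w1) * ∑ u ∈ U, sc m u))
    (φ : MvPolynomial (Fin 2) ℚ →+* ℝ) (hφ : ∀ P, φ P = 0 → P = 0)
    (h0 : φ (MvPolynomial.X 0) = m 1) (h1 : φ (MvPolynomial.X 1) = m 2) : False := by
  have hφM : ∀ i, φ (PM i) = m i := by
    rw [Fin.sum_univ_four] at hsum
    have hhalf : φ (MvPolynomial.C (1/2)) = 1/2 := by
      have : φ (MvPolynomial.C (1/2)) = (φ.comp MvPolynomial.C) (1/2) := rfl
      rw [this, map_div₀]; simp
    intro i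
    fin_cases i
    · simp only [PM]
      simp only [Fin.zero_eta, Matrix.cons_val_zero, map_mul, map_sub, map_one, h0, h1, hhalf]
      linarith
    · simpa [PM] using h0
    · simpa [PM] using h1
    · simp only [PM]
      simp only [Fin.reduceFinMk, Matrix.cons_val, map_mul, map_sub, map_one, h0, h1, hhalf]
      linarith
  have hφi : Function.Injective φ := (injective_iff_map_eq_zero φ).2 hφ
  have hφsc : ∀ w, φ (sc PM w) = sc m w := fun w => by
    rw [sc_hom]; congr 1; funext i; exact hφM i
  set Qp : MvPolynomial (Fin 2) ℚ := sc PM w0 * ∑ u ∈ U', sc PM u with hQp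
  have hQ0 : Qp ≠ 0 := by
    intro h
    have : φ Qp = 0 := by rw [h, map_zero]
    rw [hQp, map_mul, map_sum, hφsc] at this
    simp only [hφsc] at this
    exact (mul_pos (sc_pos hm w0) hU').ne' this
  have hidp : ∀ w1, Y w1 → ∃ (k N : ℕ) (U : Finset (List (Fin 4))),
        (∀ u : List (Fin 4), u.length = N → Y (w1 ++ u) → u ∈ U) ∧
        (PM 1 + PM 2) * PM 0 ^ k * Qp =
          PM 1 * PM 0 * (sc PM (w0 ++ w1) * ∑ u ∈ U, sc PM u) := by
    intro w1 hw1
    obtain ⟨k, N, U, hU, e⟩ := hid w1 hw1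
    refine ⟨k, N, U, hU, hφi ?_⟩
    simp only [hQp, map_mul, map_sum, map_add, map_pow, hφsc, hφM]
    exact e
  let cnt : List (Fin 4) → ℕ := fun w => w.count 1 + w.count 2
  have hcnt : ∀ w1, Y w1 → cnt w1 ≤ 2 * Qp.totalDegree := by
    intro w1 hw1
    obtain ⟨k, N, U, -, e⟩ := hidp w1 hw1
    have key : ∀ (j : Fin 2) (i : Fin 4), PM i = MvPolynomial.X j →
        w1.count i ≤ Qp.totalDegree := by
      intro j i hij
      apply X_pow_dvd_le hQ0 j
      apply (MvPolynomial.X_prime (i := j)).pow_dvd_of_dvd_mul_left _ (not_dvd j k)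
      rw [e, ← hij, sc_append]
      exact (((sc_pow_dvd PM i w1).mul_left _).mul_right _).mul_left _
    have k1 := key 0 1 (by simp [PM])
    have k2 := key 1 2 (by simp [PM])
    simp only [cnt]; omega
  obtain ⟨w1, hw1, hmax⟩ : ∃ w1, Y w1 ∧ ∀ w2, Y w2 → cnt w2 ≤ cnt w1 := by
    have hb : BddAbove (cnt '' {w | Y w}) := by
      refine ⟨2 * Qp.totalDegree, ?_⟩
      rintro _ ⟨w, hw, rfl⟩; exact hcnt w hw
    obtain ⟨w1, hw1, e⟩ := Nat.sSup_mem (s := cnt '' {w | Y w}) ⟨_, [], hY0, rfl⟩ hb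
    refine ⟨w1, hw1, fun w2 hw2 => ?_⟩
    rw [e]; exact le_csSup hb ⟨w2, hw2, rfl⟩
  obtain ⟨k, N, U, hU, e⟩ := hidp w1 hw1
  obtain ⟨u0, hu0, hYu⟩ := hYe w1 N hw1
  have hu0U := hU u0 hu0 hYu
  have hc0 : u0.count 1 = 0 ∧ u0.count 2 = 0 := by
    have := hmax _ hYu
    simp only [cnt, List.count_append] at this
    omega
  -- specialisation
  let σ : MvPolynomial (Fin 2) ℚ →+* Polynomial ℚ :=
    MvPolynomial.eval₂Hom Polynomial.C ![Polynomial.X, -Polynomial.X]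
  have s0 : σ (PM 0) = Polynomial.C (1/2) := by simp [σ, PM]
  have s1 : σ (PM 1) = Polynomial.X := by simp [σ, PM]
  have s2 : σ (PM 2) = -Polynomial.X := by simp [σ, PM]
  have s3 : σ (PM 3) = Polynomial.C (1/2) := by simp [σ, PM]
  have hhalf : (Polynomial.C (1/2) : Polynomial ℚ) ≠ 0 := by simp
  have hne : ∀ i, σ (PM i) ≠ 0 := by
    intro i
    fin_cases i
    · exact s0 ▸ hhalf
    · exact s1 ▸ Polynomial.X_ne_zero
    · exact s2 ▸ neg_ne_zero.2 Polynomial.X_ne_zero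
    · exact s3 ▸ hhalf
  have es := congrArg σ e
  simp only [map_mul, map_add, s1, s2, add_neg_cancel, zero_mul] at es
  rw [sc_hom] at es
  have hpp : σ (∑ u ∈ U, sc PM u) = 0 := by
    rcases mul_eq_zero.1 es.symm with h | h
    · exact absurd h (mul_ne_zero Polynomial.X_ne_zero (hne 0))
    · exact (mul_eq_zero.1 h).resolve_left (sc_ne_zero _ hne _)
  let ε : MvPolynomial (Fin 2) ℚ →+* ℚ := (Polynomial.evalRingHom 0).comp σ
  have e0 : ∀ i, ε (PM i) = if i = 0 ∨ i = 3 then 1/2 else 0 := by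
    intro i
    have hε : ε (PM i) = Polynomial.eval 0 (σ (PM i)) := rfl
    rw [hε]
    fin_cases i
    · simp only [Fin.zero_eta]; rw [s0]; simp
    · simp only [Fin.mk_one]; rw [s1]; simp
    · simp only [Fin.reduceFinMk]; rw [s2]; simp
    · simp only [Fin.reduceFinMk]; rw [s3]; simp
  have hεp : ∑ u ∈ U, ε (sc PM u) = 0 := by
    rw [← map_sum]
    change Polynomial.eval 0 (σ (∑ u ∈ U, sc PM u)) = 0
    rw [hpp]; simp
  have hnn : ∀ u : List (Fin 4), 0 ≤ ε (sc PM u) := by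
    intro u
    induction u with
    | nil => simp [sc_nil]
    | cons i u ih =>
      rw [sc_cons, map_mul]
      refine mul_nonneg ?_ ih
      rw [e0]; split_ifs <;> norm_num
  have hpos : ∀ u : List (Fin 4), u.count 1 = 0 → u.count 2 = 0 → 0 < ε (sc PM u) := by
    intro u
    induction u with
    | nil => intros; simp [sc_nil]
    | cons i u ih =>
      intro h1 h2
      rw [List.count_eq_zero, List.mem_cons, not_or, ← List.count_eq_zero] at h1 h2
      rw [sc_cons, map_mul]
      refine mul_pos ?_ (ih h1.2 h2.2)
      rw [e0]
      have h3 := h1.1; have h4 := h2.1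
      fin_cases i <;> simp at *
  have := (Finset.sum_eq_zero_iff_of_nonneg (fun u _ => hnn u)).1 hεp u0 hu0U
  exact (hpos u0 hc0.1 hc0.2).ne' this

end FB

/-- Theorem 1.2: for `n = 4`, `ρ₁ = ρ₄`, `Σ_T = {2}`, Lipschitz
equivalence of `D` and `T` forces `μ₂ = ρ₂^s` and `μ₃ = ρ₃^s` to be algebraically
dependent over `ℚ`. -/
theorem four_branch_algebraic_dependence {ρ : ℕ → ℝ}
    (hρ : ContractionVec 4 ρ) (hρ14 : ρ 0 = ρ 3)
    (S : TouchingIFS 4 ρ) (Q : DustIFS 4 ρ)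
    (htouch : S.touch 1) (hnt0 : ¬ S.touch 0) (hnt2 : ¬ S.touch 2)
    (s : ℝ) (hs : (∑ i ∈ Finset.range 4, ρ i ^ s) = 1)
    (h : LipEquivOn Q.D S.T) :
    ∃ P : MvPolynomial (Fin 2) ℚ, P ≠ 0 ∧
      MvPolynomial.aeval (fun j : Fin 2 => if j = 0 then ρ 1 ^ s else ρ 2 ^ s) P = 0 := by
  by_contra hno
  push Not at hno
  obtain ⟨f, c, c', hc, hcc, hbij, hlip⟩ := h
  have hp0 := hρ.pos 0 (by norm_num)
  have hp1 := hρ.pos 1 (by norm_num)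
  have hp2 := hρ.pos 2 (by norm_num)
  have hp3 := hρ.pos 3 (by norm_num)
  have hsl := hρ.sum_lt
  have hrange : ∀ F : ℕ → ℝ, ∑ i ∈ Finset.range 4, F i = F 0 + F 1 + F 2 + F 3 := by
    intro F; simp [Finset.sum_range_succ]
  have hun : ∀ (t : ℕ → ℝ) (X : Set ℝ), (⋃ i ∈ Finset.range 4, affMap ρ t i '' X) =
      ⋃ i : Fin 4, (fun x => ρ i * x + t i) '' X := by
    intro t X
    ext x
    simp only [mem_iUnion, Finset.mem_range, mem_image, affMap]
    constructor
    · rintro ⟨i, hi, y, hy, e⟩; exact ⟨⟨i, hi⟩, y, hy, e⟩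
    · rintro ⟨i, y, hy, e⟩; exact ⟨i, i.2, y, hy, e⟩
  rw [hrange] at hs hsl
  have hpos : ∀ i : Fin 4, 0 < ρ i := fun i => hρ.pos i i.2
  have hlt : ∀ i : Fin 4, ρ i < 1 := fun i => hρ.lt_one i i.2
  -- the dimension is positive
  have hspos : 0 < s := by
    by_contra hcon
    push Not at hcon
    have h0 := Real.one_le_rpow_of_pos_of_le_one_of_nonpos hp0 (hρ.lt_one 0 (by norm_num)).le hcon
    have h1 := Real.rpow_pos_of_pos hp1 s
    have h2 := Real.rpow_pos_of_pos hp2 s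
    have h3 := Real.rpow_pos_of_pos hp3 s
    linarith
  -- touching system
  have tc : FB.Tch (fun i => ρ i) (fun i => S.t i) S.T := by
    have o0 := S.order 0 (by norm_num)
    have o2 := S.order 2 (by norm_num)
    have l0 := S.left0
    have r1 := S.right1
    have t1 := htouch.2
    have n0 : affMap ρ S.t 0 1 ≠ affMap ρ S.t (0 + 1) 0 := fun e => hnt0 ⟨by norm_num, e⟩
    have n2 : affMap ρ S.t 2 1 ≠ affMap ρ S.t (2 + 1) 0 := fun e => hnt2 ⟨by norm_num, e⟩
    have o0' := lt_of_le_of_ne o0 n0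
    have o2' := lt_of_le_of_ne o2 n2
    simp only [affMap, mul_one, mul_zero, zero_add] at o0' o2' l0 r1 t1
    norm_num at o0' o2' r1 t1
    refine ⟨hpos, by simpa using hρ14, by simpa using l0, ?_, ?_, ?_, ?_, S.compactT,
      S.nonemptyT, ?_⟩
    · simp; linarith
    · simp; linarith
    · simp; linarith
    · simp; linarith
    · exact S.invT.trans (hun _ _)
  -- dust system
  set g := (1 - (ρ 0 + ρ 1 + ρ 2 + ρ 3)) / 3 with hg
  have hgpos : 0 < g := by rw [hg]; linarith
  have g0 := Q.equal_gap 0 (by norm_num)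
  have g1 := Q.equal_gap 1 (by norm_num)
  have g2 := Q.equal_gap 2 (by norm_num)
  have l0 := Q.left0
  have r1 := Q.right1
  rw [hrange] at g0 g1 g2
  simp only [affMap, mul_one, mul_zero, zero_add] at g0 g1 g2 l0 r1
  norm_num at g0 g1 g2 r1
  rw [← hg] at g0 g1 g2
  have hinvD := Q.invD.trans (hun _ _)
  have hunit : Q.D ⊆ Icc 0 1 := by
    refine FB.sub_unit hinvD Q.compactD Q.nonemptyD hpos hlt ?_ ?_
    · intro i; fin_cases i <;> simp <;> linarith
    · intro i; fin_cases i <;> simp <;> linarith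
  have hsep : FB.Sep (fun i => ρ i) (fun i => Q.d i) Q.D g := by
    have key : ∀ i j : Fin 4, i < j → ∀ x ∈ Q.D, ∀ y ∈ Q.D,
        g ≤ (ρ j * y + Q.d j) - (ρ i * x + Q.d i) := by
      intro i j hij x hx y hy
      have hx1 := (hunit hx).2
      have hy0 := (hunit hy).1
      have a1 : ρ i * x ≤ ρ i := by nlinarith [hpos i]
      have a2 : 0 ≤ ρ j * y := mul_nonneg (hpos j).le hy0
      suffices g ≤ Q.d j - (ρ i + Q.d i) by linarith
      fin_cases i <;> fin_cases j <;> simp at hij ⊢ <;> linarith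
    intro i j hij x hx y hy
    rcases lt_or_gt_of_ne hij with hl | hl
    · have := key i j hl x hx y hy
      rw [abs_sub_comm]
      exact this.trans (le_abs_self _)
    · have := key j i hl y hy x hx
      exact this.trans (le_abs_self _)
  have E : FB.Eqv (fun i => ρ i) (fun i => S.t i) (fun i => Q.d i) S.T Q.D g s c c' f :=
    { tc := tc
      comp := Q.compactD
      ne := Q.nonemptyD
      inv := hinvD
      gpos := hgpos
      sep := hsep
      unit := hunit
      spos := hspos
      sum := by rw [Fin.sum_univ_four]; simpa using hs
      cpos := hc
      cle := hcc
      bij := hbij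
      lo := fun x hx y hy => (hlip x hx y hy).1
      hi := fun x hx y hy => (hlip x hx y hy).2 }
  obtain ⟨w0, y, U', hy, hU', hid⟩ := E.identity rfl
  refine FB.alg (fun i : Fin 4 => ρ i ^ s) (fun i => Real.rpow_pos_of_pos (hpos i) s)
    (by simp [hρ14]) E.sum
    (fun w => y ∈ FB.W (fun i => ρ i) (fun i => Q.d i) (w0 ++ w) '' Q.D)
    (by simpa using hy) ?_ w0 U' hU' ?_
    (MvPolynomial.aeval (fun j : Fin 2 => if j = 0 then ρ 1 ^ s else ρ 2 ^ s)).toRingHom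
    ?_ (by simp) (by simp)
  · intro w N hw
    obtain ⟨u, hu, hyu⟩ := FB.cyl_exists' hinvD N _ y hw
    exact ⟨u, hu, by rw [← List.append_assoc]; exact hyu⟩
  · intro w1 hw1
    obtain ⟨k, N, U, a, b⟩ := hid w1 hw1
    exact ⟨k, N, U, fun u hu hyu => a u hu (by rw [List.append_assoc]; exact hyu), b⟩
  · intro P hP
    by_contra hP0
    exact hno P hP0 hP
end
end
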